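/- arXiv:1402.0229 — 3 statements merged into one kernel-verified Lean document; each statement's English description precedes it below -/
import Mathlib

section
/- (Kirillov–Noumi, Warnaar.) Let n ≥ 1. Then Σ_λ ∏_{i=0}^{∞} ∏_{j=1}^{m_i(λ)} (1−t^j) · P_λ(x_1,…,x_n;t) · P_λ(y_1,…,y_n;t) = ( ∏_{i,j=1}^{n} (1−t x_i y_j) / (Δ(x)_n Δ(y)_n) ) · det[ (1−t) / ((1−x_i y_j)(1−t x_i y_j)) ]_{1≤i,j≤n}, where the sum is over all partitions λ with ℓ(λ) ≤ n and in the product over i the multiplicity of the part 0 is taken to be m_0(λ) = n − ℓ(λ). -/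
noncomputable section

open scoped BigOperators

/-- The Vandermonde product `Δ(x)ₙ = ∏_{i<j} (x i - x j)`. -/
def vprod {n : ℕ} (x : Fin n → ℂ) : ℂ :=
  ∏ i : Fin n, ∏ j ∈ Finset.Ioi i, (x i - x j)

/-- `mult l i` is the multiplicity `m_i(λ)` of the part `i` in the partition `λ` recorded
by `l : Fin n → ℕ`; in particular `mult l 0 = n - ℓ(λ)`. -/
def mult {n : ℕ} (l : Fin n → ℕ) (i : ℕ) : ℕ :=
  (Finset.univ.filter fun k => l k = i).card

/-- `v_λ(t) = ∏_{i≥0} ∏_{j=1}^{m_i(λ)} (1-t^j)/(1-t)`, with `m₀(λ) = n - ℓ(λ)`. -/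
def vlam {n : ℕ} (l : Fin n → ℕ) (t : ℂ) : ℂ :=
  ∏ i ∈ Finset.range (Finset.univ.sup l + 1),
    ∏ j ∈ Finset.range (mult l i), ((1 - t ^ (j + 1)) / (1 - t))

/-- The Hall–Littlewood polynomial
`P_λ(x₁,…,xₙ;t) = v_λ(t)⁻¹ Σ_{σ∈Sₙ} σ(x₁^{λ₁}⋯xₙ^{λₙ} ∏_{i<j} (xᵢ-t xⱼ)/(xᵢ-xⱼ))`. -/
def hallLittlewood {n : ℕ} (l : Fin n → ℕ) (x : Fin n → ℂ) (t : ℂ) : ℂ :=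
  (vlam l t)⁻¹ *
    ∑ σ : Equiv.Perm (Fin n),
      (∏ i : Fin n, x (σ i) ^ l i) *
        ∏ i : Fin n, ∏ j ∈ Finset.Ioi i, (x (σ i) - t * x (σ j)) / (x (σ i) - x (σ j))

/-- `∏_{i≥0} ∏_{j=1}^{m_i(λ)} (1-t^j)`, with `m₀(λ) = n - ℓ(λ)`. -/
def bfac0 {n : ℕ} (l : Fin n → ℕ) (t : ℂ) : ℂ :=
  ∏ i ∈ Finset.range (Finset.univ.sup l + 1),
    ∏ j ∈ Finset.range (mult l i), (1 - t ^ (j + 1))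


section Symmetrization

variable {ι : Type*} [DecidableEq ι]

/-- `∏_{b ∈ K} (x_a - t x_b) / (x_a - x_b)`. -/
def hlFactor (t : ℂ) (x : ι → ℂ) (a : ι) (K : Finset ι) : ℂ :=
  ∏ b ∈ K, (x a - t * x b) / (x a - x b)

/-- `∏_{a ∈ I, b ∈ K} (x_a - t x_b) / (x_a - x_b)`. -/
def hlWeight (t : ℂ) (x : ι → ℂ) (I K : Finset ι) : ℂ :=
  ∏ a ∈ I, hlFactor t x a K

/-- The Hall–Littlewood symmetrization of `g₀(x₁) ⋯ g_{k-1}(x_k)` over the variables indexed by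
the set `S` (of cardinality `k`). -/
def hlSym (t : ℂ) (x : ι → ℂ) : ℕ → (ℕ → ℂ → ℂ) → Finset ι → ℂ
  | 0, _, _ => 1
  | k + 1, g, S => ∑ a ∈ S, g 0 (x a) * hlFactor t x a (S.erase a) *
      hlSym t x k (fun j => g (j + 1)) (S.erase a)

/-- The right-hand side of the refined Cauchy identity in the variables `x_a`, `a ∈ S`, and the
variables in the list, written as a sum over bijections. -/
def kernelSum (t : ℂ) (x : ι → ℂ) : List ℂ → Finset ι → ℂ
  | [], _ => 1
  | z :: l, S => ∑ a ∈ S, (1 - t) / (1 - x a * z) *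
      (l.map fun c => (1 - t * (x a * c)) / (1 - x a * c)).prod * hlFactor t x a (S.erase a) *
      kernelSum t x l (S.erase a)

/-- `∏_{j=1}^{k} (1 - t^j)`. -/
def qfac (t : ℂ) (k : ℕ) : ℂ := ∏ j ∈ Finset.range k, (1 - t ^ (j + 1))

theorem sum_hlFactor_erase (t : ℂ) (x : ι → ℂ) {S : Finset ι} (hx : Set.InjOn x S) :
    (1 - t) * ∑ a ∈ S, hlFactor t x a (S.erase a) = 1 - t ^ S.card := by
  open Polynomial in
  rcases S.eq_empty_or_nonempty with rfl | hS
  · simp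
  have hn : 0 < S.card := hS.card_pos
  let W : ℂ[X] := ∏ j ∈ S, (X - C (t * x j)) - C (t ^ S.card) * ∏ j ∈ S, (X - C (x j))
  have hm1 : (∏ j ∈ S, (X - C (t * x j))).Monic := monic_prod_of_monic _ _ fun j _ => monic_X_sub_C _
  have hm2 : (∏ j ∈ S, (X - C (x j))).Monic := monic_prod_of_monic _ _ fun j _ => monic_X_sub_C _
  have hd1 : (∏ j ∈ S, (X - C (t * x j))).natDegree = S.card := by
    rw [natDegree_prod_of_monic _ _ fun j _ => monic_X_sub_C _]
    simp only [natDegree_X_sub_C, Finset.sum_const, smul_eq_mul, mul_one]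
  have hd2 : (∏ j ∈ S, (X - C (x j))).natDegree = S.card := by
    rw [natDegree_prod_of_monic _ _ fun j _ => monic_X_sub_C _]
    simp only [natDegree_X_sub_C, Finset.sum_const, smul_eq_mul, mul_one]
  have hWd : W.natDegree ≤ S.card := by
    refine (natDegree_sub_le _ _).trans (max_le hd1.le ?_)
    exact (natDegree_C_mul_le _ _).trans hd2.le
  have hWc : W.coeff S.card = 1 - t ^ S.card := by
    have h1 := hm1.coeff_natDegree
    have h2 := hm2.coeff_natDegree
    rw [hd1] at h1
    rw [hd2] at h2
    simp only [W, coeff_sub, coeff_C_mul, h1, h2, mul_one]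
  have hW0 : W.coeff 0 = 0 := by
    rw [coeff_zero_eq_eval_zero]
    simp only [W, eval_sub, eval_mul, eval_prod, eval_C, eval_X, zero_sub, ← mul_neg,
      Finset.prod_mul_distrib, Finset.prod_const, sub_self]
  have hWX : W = X * W.divX := by
    have := W.X_mul_divX_add
    rw [hW0, C_0, add_zero] at this
    exact this.symm
  have heval : ∀ a ∈ S, W.divX.eval (x a) = (1 - t) * ∏ b ∈ S.erase a, (x a - t * x b) := by
    intro a ha
    have hcard : S.card = (S.erase a).card + 1 := (Finset.card_erase_add_one ha).symm
    rcases eq_or_ne (x a) 0 with h0 | h0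
    · have : W = (∏ j ∈ S.erase a, (X - C (t * x j)) -
          C (t ^ S.card) * ∏ j ∈ S.erase a, (X - C (x j))) * X := by
        simp only [W]
        rw [← Finset.mul_prod_erase S _ ha, ← Finset.mul_prod_erase S _ ha, h0]
        simp
        ring
      have hX : W.divX = ∏ j ∈ S.erase a, (X - C (t * x j)) -
          C (t ^ S.card) * ∏ j ∈ S.erase a, (X - C (x j)) := by
        rw [hWX, mul_comm] at this
        exact mul_right_cancel₀ X_ne_zero this
      rw [hX, h0]
      simp only [eval_sub, eval_mul, eval_prod, eval_C, eval_X, zero_sub, ← mul_neg,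
        Finset.prod_mul_distrib, Finset.prod_const, hcard]
      ring
    · have h := congrArg (eval (x a)) hWX
      simp only [eval_mul, eval_X] at h
      have h2 : W.eval (x a) = x a * ((1 - t) * ∏ b ∈ S.erase a, (x a - t * x b)) := by
        simp only [W, eval_sub, eval_mul, eval_prod, eval_C, eval_X]
        rw [← Finset.mul_prod_erase S _ ha, ← Finset.mul_prod_erase S (fun j => x a - x j) ha]
        ring
      exact mul_left_cancel₀ h0 (h.symm.trans h2)
  have hdeg : W.divX.degree < S.card := by
    refine (degree_lt_iff_coeff_zero _ _).2 fun m hm => ?_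
    rw [coeff_divX]
    exact coeff_eq_zero_of_natDegree_lt (by omega)
  have key := Lagrange.coeff_eq_sum hx hdeg
  rw [coeff_divX, Nat.sub_add_cancel hn, hWc] at key
  rw [key, Finset.mul_sum]
  refine Finset.sum_congr rfl fun a ha => ?_
  rw [heval a ha, hlFactor, Finset.prod_div_distrib]
  ring

theorem hlSym_one {t : ℂ} (ht : t ≠ 1) (x : ι → ℂ) (k : ℕ) {S : Finset ι} (hS : S.card = k)
    (hx : Set.InjOn x S) :
    hlSym t x k (fun _ _ => 1) S = ∏ j ∈ Finset.range k, ((1 - t ^ (j + 1)) / (1 - t)) := by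
  induction k generalizing S with
  | zero => simp [hlSym]
  | succ k ih =>
    have h1 : (1 - t) ≠ 0 := sub_ne_zero.2 ht.symm
    rw [hlSym, Finset.prod_range_succ, ← hS, ← sum_hlFactor_erase t x hx,
      mul_div_cancel_left₀ _ h1, Finset.mul_sum]
    refine Finset.sum_congr rfl fun a ha => ?_
    rw [ih (by rw [Finset.card_erase_of_mem ha, hS]; rfl)
      (hx.mono (by simp))]
    ring

theorem kernelSum_zero (t : ℂ) (x : ι → ℂ) (k : ℕ) {S : Finset ι} (hS : S.card = k)
    (hx : Set.InjOn x S) : kernelSum t x (List.replicate k 0) S = qfac t k := by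
  induction k generalizing S with
  | zero => simp [kernelSum, qfac]
  | succ k ih =>
    rw [List.replicate_succ, kernelSum, qfac, Finset.prod_range_succ, ← hS,
      ← sum_hlFactor_erase t x hx, Finset.mul_sum, Finset.mul_sum]
    refine Finset.sum_congr rfl fun a ha => ?_
    rw [ih (by rw [Finset.card_erase_of_mem ha, hS]; rfl)
      (hx.mono (by simp)), qfac]
    simp
    ring

theorem hlSym_congr (t : ℂ) (x : ι → ℂ) {k : ℕ} {g h : ℕ → ℂ → ℂ} (hgh : ∀ j < k, g j = h j)
    (S : Finset ι) : hlSym t x k g S = hlSym t x k h S := by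
  induction k generalizing S g h with
  | zero => rfl
  | succ k ih =>
    rw [hlSym, hlSym, hgh 0 k.succ_pos]
    refine Finset.sum_congr rfl fun a _ => ?_
    rw [ih fun j hj => hgh (j + 1) (by omega)]

theorem hlSym_mul (t : ℂ) (x : ι → ℂ) {k : ℕ} (f : ℂ → ℂ) (g : ℕ → ℂ → ℂ) {S : Finset ι}
    (hS : S.card = k) :
    hlSym t x k (fun j z => f z * g j z) S = (∏ a ∈ S, f (x a)) * hlSym t x k g S := by
  induction k generalizing S g with
  | zero => simp [Finset.card_eq_zero.1 hS, hlSym]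
  | succ k ih =>
    rw [hlSym, hlSym, Finset.mul_sum]
    refine Finset.sum_congr rfl fun a ha => ?_
    rw [ih _ (by rw [Finset.card_erase_of_mem ha, hS]; rfl), ← Finset.mul_prod_erase S _ ha]
    ring

theorem hlWeight_insert_left (t : ℂ) (x : ι → ℂ) {a : ι} {I : Finset ι} (K : Finset ι)
    (ha : a ∉ I) : hlWeight t x (insert a I) K = hlFactor t x a K * hlWeight t x I K :=
  Finset.prod_insert ha

theorem hlFactor_insert (t : ℂ) (x : ι → ℂ) (a : ι) {b : ι} {K : Finset ι} (hb : b ∉ K) :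
    hlFactor t x a (insert b K) = (x a - t * x b) / (x a - x b) * hlFactor t x a K :=
  Finset.prod_insert hb

theorem hlWeight_insert_right (t : ℂ) (x : ι → ℂ) (I : Finset ι) {b : ι} {K : Finset ι}
    (hb : b ∉ K) : hlWeight t x I (insert b K) =
      (∏ a ∈ I, (x a - t * x b) / (x a - x b)) * hlWeight t x I K := by
  simp only [hlWeight, hlFactor_insert t x _ hb, Finset.prod_mul_distrib]

theorem hlFactor_union (t : ℂ) (x : ι → ℂ) (a : ι) {K L : Finset ι} (h : Disjoint K L) :
    hlFactor t x a (K ∪ L) = hlFactor t x a K * hlFactor t x a L :=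
  Finset.prod_union h

/-- Symmetrizing over `S` amounts to choosing the set `I` of the first `m` variables and
symmetrizing over `I` and `S \ I`. -/
theorem hlSym_add (t : ℂ) (x : ι → ℂ) (m k : ℕ) (g : ℕ → ℂ → ℂ) (S : Finset ι) :
    hlSym t x (m + k) g S = ∑ I ∈ S.powersetCard m,
      hlWeight t x I (S \ I) * hlSym t x m g I * hlSym t x k (fun j => g (m + j)) (S \ I) := by
  induction m generalizing S g with
  | zero => simp [hlSym, hlWeight]
  | succ m ih =>
    have hstep : hlSym t x (m + 1 + k) g S = ∑ a ∈ S, g 0 (x a) * hlFactor t x a (S.erase a) *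
        hlSym t x (m + k) (fun j => g (j + 1)) (S.erase a) := by
      rw [show m + 1 + k = m + k + 1 by ring, hlSym]
    have hg : (fun j => g (m + 1 + j)) = fun j => g (m + j + 1) := by
      funext j; congr 1; ring
    rw [hstep, hg]
    simp only [ih, hlSym, Finset.mul_sum, Finset.sum_mul]
    rw [Finset.sum_sigma', Finset.sum_sigma']
    refine Finset.sum_bij' (fun p _ => ⟨insert p.1 p.2, p.1⟩) (fun p _ => ⟨p.2, p.1.erase p.2⟩)
      ?_ ?_ ?_ ?_ ?_
    · rintro ⟨a, I⟩ h
      simp only [Finset.mem_sigma, Finset.mem_powersetCard] at h ⊢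
      obtain ⟨ha, hI, hc⟩ := h
      have haI : a ∉ I := fun h => by simpa using hI h
      refine ⟨⟨Finset.insert_subset ha (hI.trans (Finset.erase_subset _ _)), ?_⟩, by simp⟩
      rw [Finset.card_insert_of_notMem haI, hc]
    · rintro ⟨I, a⟩ h
      simp only [Finset.mem_sigma, Finset.mem_powersetCard] at h ⊢
      obtain ⟨⟨hI, hc⟩, ha⟩ := h
      exact ⟨hI ha, Finset.erase_subset_erase _ hI, by rw [Finset.card_erase_of_mem ha, hc]; rfl⟩
    · rintro ⟨a, I⟩ h
      simp only [Finset.mem_sigma, Finset.mem_powersetCard] at h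
      have haI : a ∉ I := fun h' => by simpa using h.2.1 h'
      simp [Finset.erase_insert haI]
    · rintro ⟨I, a⟩ h
      simp only [Finset.mem_sigma] at h
      simp [Finset.insert_erase h.2]
    · rintro ⟨a, I⟩ h
      simp only [Finset.mem_sigma, Finset.mem_powersetCard] at h
      obtain ⟨ha, hI, hc⟩ := h
      have haI : a ∉ I := fun h' => by simpa using hI h'
      have hd : S \ insert a I = S.erase a \ I := by
        ext b; simp only [Finset.mem_sdiff, Finset.mem_insert, Finset.mem_erase]; tauto
      have hu : S.erase a = I ∪ (S.erase a \ I) := by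
        rw [Finset.union_sdiff_of_subset hI]
      simp only [hd, Finset.erase_insert haI, hlWeight_insert_left t x _ haI]
      rw [show hlFactor t x a (S.erase a) = hlFactor t x a I * hlFactor t x a (S.erase a \ I) by
        rw [← hlFactor_union t x a Finset.disjoint_sdiff, ← hu]]
      ring

end Symmetrization

section Reindexing

variable {ι κ : Type*}

theorem hlFactor_map (t : ℂ) (x : κ → ℂ) (e : ι ↪ κ) (a : ι) (K : Finset ι) :
    hlFactor t x (e a) (K.map e) = hlFactor t (x ∘ e) a K := by
  simp [hlFactor]

variable [DecidableEq ι] [DecidableEq κ]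

theorem hlSym_map (t : ℂ) (x : κ → ℂ) (e : ι ↪ κ) (k : ℕ) (g : ℕ → ℂ → ℂ) (S : Finset ι) :
    hlSym t x k g (S.map e) = hlSym t (x ∘ e) k g S := by
  induction k generalizing S g with
  | zero => rfl
  | succ k ih =>
    rw [hlSym, hlSym, Finset.sum_map]
    refine Finset.sum_congr rfl fun a _ => ?_
    rw [← Finset.map_erase, hlFactor_map, ih, Function.comp_apply]

theorem kernelSum_map (t : ℂ) (x : κ → ℂ) (e : ι ↪ κ) (l : List ℂ) (S : Finset ι) :
    kernelSum t x l (S.map e) = kernelSum t (x ∘ e) l S := by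
  induction l generalizing S with
  | nil => rfl
  | cons z l ih =>
    rw [kernelSum, kernelSum, Finset.sum_map]
    refine Finset.sum_congr rfl fun a _ => ?_
    rw [← Finset.map_erase, hlFactor_map, ih, Function.comp_apply]

end Reindexing

theorem sum_perm_eq_hlSym (t : ℂ) {n : ℕ} (g : ℕ → ℂ → ℂ) (x : Fin n → ℂ) :
    ∑ σ : Equiv.Perm (Fin n), (∏ i : Fin n, g i (x (σ i))) *
        ∏ i : Fin n, ∏ j ∈ Finset.Ioi i, (x (σ i) - t * x (σ j)) / (x (σ i) - x (σ j)) =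
      hlSym t x n g Finset.univ := by
  induction n generalizing g with
  | zero => simp [hlSym]
  | succ n ih =>
    rw [← Equiv.Perm.decomposeFin.symm.sum_comp, Fintype.sum_prod_type, hlSym]
    refine Finset.sum_congr rfl fun p _ => ?_
    let e : Fin n ↪ Fin (n + 1) := (Fin.succEmb n).trans (Equiv.swap 0 p).toEmbedding
    have he : Finset.univ.erase p = Finset.univ.map e := by
      rw [← Finset.map_map]
      ext b
      simp only [Finset.mem_erase, Finset.mem_univ, and_true, Finset.mem_map, true_and,
        Equiv.coe_toEmbedding]
      constructor
      · intro hb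
        refine ⟨Equiv.swap 0 p b, ?_, by simp⟩
        have : Equiv.swap 0 p b ≠ 0 := by
          intro h0
          apply hb
          rw [← Equiv.swap_apply_self 0 p b, h0, Equiv.swap_apply_left]
        exact ⟨(Equiv.swap 0 p b).pred this, Fin.succ_pred _ this⟩
      · rintro ⟨c, ⟨d, hd⟩, rfl⟩ h
        have : c = 0 := by
          have h2 := congrArg (Equiv.swap 0 p) h
          rwa [Equiv.swap_apply_self, Equiv.swap_apply_right] at h2
        exact Fin.succ_ne_zero d (hd.trans this)
    rw [he, hlSym_map, ← ih, Finset.mul_sum]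
    refine Finset.sum_congr rfl fun σ _ => ?_
    have hs : ∀ i : Fin n, Equiv.Perm.decomposeFin.symm (p, σ) i.succ = e (σ i) := by
      intro i; simp [e]
    have h0 : hlFactor t x p (Finset.univ.map e) =
        ∏ i, (x p - t * x (e (σ i))) / (x p - x (e (σ i))) := by
      rw [hlFactor, Finset.prod_map, ← Equiv.prod_comp σ]
    rw [Fin.prod_univ_succ, Fin.prod_univ_succ, h0, Fin.prod_Ioi_zero]
    simp only [hs, Fin.prod_Ioi_succ, Equiv.Perm.decomposeFin_symm_apply_zero, Function.comp_apply,
      Fin.val_zero, Fin.val_succ]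
    ring

theorem vprod_eq_det {n : ℕ} (x : Fin n → ℂ) :
    vprod x = (Matrix.vandermonde fun i => -x i).det := by
  rw [Matrix.det_vandermonde]
  simp only [vprod, neg_sub_neg]

theorem vprod_comp_perm {n : ℕ} (x : Fin n → ℂ) (σ : Equiv.Perm (Fin n)) :
    vprod (x ∘ σ) = (Equiv.Perm.sign σ : ℂ) * vprod x := by
  rw [vprod_eq_det, vprod_eq_det, ← Matrix.det_permute]
  rfl

theorem vprod_succ {n : ℕ} (x : Fin (n + 1) → ℂ) :
    vprod x = (∏ j : Fin n, (x 0 - x j.succ)) * vprod fun j : Fin n => x j.succ := by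
  simp only [vprod, Fin.prod_univ_succ, Fin.prod_Ioi_zero, Fin.prod_Ioi_succ]

theorem vprod_ne_zero {n : ℕ} {x : Fin n → ℂ} (hx : Function.Injective x) : vprod x ≠ 0 := by
  refine Finset.prod_ne_zero_iff.2 fun i _ => Finset.prod_ne_zero_iff.2 fun j hj => ?_
  exact sub_ne_zero.2 (hx.ne (Finset.mem_Ioi.1 hj).ne)

theorem vprod_succAbove {n : ℕ} (x : Fin (n + 1) → ℂ) (a : Fin (n + 1)) :
    vprod x = (-1) ^ (a : ℕ) * (∏ j : Fin n, (x a - x (a.succAbove j))) *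
      vprod (x ∘ a.succAbove) := by
  have h := vprod_comp_perm x a.cycleRange.symm
  rw [vprod_succ] at h
  simp only [Function.comp_apply, Fin.cycleRange_symm_zero, Fin.cycleRange_symm_succ,
    Equiv.Perm.sign_symm, Fin.sign_cycleRange] at h
  have h1 : ((-1 : ℂ) ^ (a : ℕ)) * (-1) ^ (a : ℕ) = 1 := by
    rw [← mul_pow]; simp
  calc vprod x = ((-1 : ℂ) ^ (a : ℕ)) * ((-1) ^ (a : ℕ) * vprod x) := by
        rw [← mul_assoc, h1, one_mul]
    _ = _ := by
        rw [mul_assoc ((-1 : ℂ) ^ (a : ℕ))]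
        congr 1
        rw [show (x ∘ a.succAbove) = fun j => x (a.succAbove j) from rfl, h]
        push_cast
        rfl

/-- The matrix with entries `(1-t) / ((1 - xᵢ yⱼ)(1 - t xᵢ yⱼ))`. -/
def kernelMatrix (t : ℂ) {n : ℕ} (x y : Fin n → ℂ) : Matrix (Fin n) (Fin n) ℂ :=
  Matrix.of fun i j : Fin n => (1 - t) / ((1 - x i * y j) * (1 - t * (x i * y j)))

/-- The right-hand side of the refined Cauchy identity. -/
def kernelDet (t : ℂ) {n : ℕ} (x y : Fin n → ℂ) : ℂ :=
  (∏ i : Fin n, ∏ j : Fin n, (1 - t * (x i * y j))) / (vprod x * vprod y) *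
    (kernelMatrix t x y).det

theorem kernelDet_comp_perm (t : ℂ) {n : ℕ} (x y : Fin n → ℂ) (σ : Equiv.Perm (Fin n)) :
    kernelDet t x (y ∘ σ) = kernelDet t x y := by
  have hdet : (kernelMatrix t x (y ∘ σ)).det =
      (Equiv.Perm.sign σ : ℂ) * (kernelMatrix t x y).det := by
    rw [← Matrix.det_permute']
    rfl
  have hs : (Equiv.Perm.sign σ : ℂ) ≠ 0 := by
    rcases Int.units_eq_one_or (Equiv.Perm.sign σ) with h | h <;> simp [h]
  have hp : ∀ i, ∏ j : Fin n, (1 - t * (x i * (y ∘ σ) j)) = ∏ j : Fin n, (1 - t * (x i * y j)) :=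
    fun i => Equiv.prod_comp σ fun j => 1 - t * (x i * y j)
  rw [kernelDet, kernelDet, vprod_comp_perm, hdet]
  simp only [hp]
  rw [mul_left_comm (vprod x), div_mul_eq_mul_div, div_mul_eq_mul_div, mul_left_comm,
    mul_div_mul_left _ _ hs]

/-- The product `x y` avoids the poles of the kernel. -/
def Regular (t x y : ℂ) : Prop := 1 - x * y ≠ 0 ∧ 1 - t * (x * y) ≠ 0

theorem kernel_interpolation (t : ℂ) {n : ℕ} {x : Fin (n + 1) → ℂ} {y : Fin n → ℂ}
    (μ : Fin (n + 1) → ℂ) (hx : Function.Injective x) (hy : Function.Injective y)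
    (hx0 : ∀ i, x i ≠ 0) (hxy : ∀ i j, Regular t (x i) (y j))
    (hμ : ∀ j, ∑ a, μ a / ((1 - x a * y j) * (1 - t * (x a * y j))) = 0) {z : ℂ}
    (hz : ∀ i, Regular t (x i) z) :
    (∏ i, (1 - t * (x i * z))) * ∑ a, μ a / ((1 - x a * z) * (1 - t * (x a * z))) =
      (∏ j, (z - y j)) * ∑ a, μ a / (1 - x a * z) *
        ((∏ i ∈ Finset.univ.erase a, (x a - t * x i)) / ∏ j, (1 - x a * y j)) := by
  open Polynomial in
  let κ : Fin (n + 1) → ℂ :=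
    fun a => (∏ i ∈ Finset.univ.erase a, (x a - t * x i)) / ∏ j, (1 - x a * y j)
  let P : ℂ[X] := ∑ a, C (μ a) * ∏ i ∈ Finset.univ.erase a,
    ((1 - C (x i) * X) * (1 - C (t * x i) * X))
  let Q : ℂ[X] := (∏ j, (X - C (y j))) *
    ∑ a, C (μ a * κ a) * ∏ i ∈ Finset.univ.erase a, (1 - C (x i) * X)
  have hlin : ∀ c : ℂ, (1 - C c * X).natDegree ≤ 1 := fun c => by
    compute_degree
  have hcard : ∀ a : Fin (n + 1), (Finset.univ.erase a).card = n := fun a => by simp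
  have hPd : P.natDegree ≤ 2 * n := by
    refine natDegree_sum_le_of_forall_le _ _ fun a _ => (natDegree_C_mul_le _ _).trans ?_
    refine (natDegree_prod_le _ _).trans ((Finset.sum_le_card_nsmul _ _ 2 fun i _ => ?_).trans ?_)
    · exact natDegree_mul_le.trans (add_le_add (hlin _) (hlin _))
    · rw [hcard, smul_eq_mul, mul_comm]
  have hQd : Q.natDegree ≤ 2 * n := by
    refine natDegree_mul_le.trans (two_mul n ▸ add_le_add ?_ ?_)
    · rw [natDegree_prod_of_monic _ _ fun j _ => monic_X_sub_C _]
      simp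
    · refine natDegree_sum_le_of_forall_le _ _ fun a _ => (natDegree_C_mul_le _ _).trans ?_
      refine (natDegree_prod_le _ _).trans
        ((Finset.sum_le_card_nsmul _ _ 1 fun i _ => hlin _).trans ?_)
      rw [hcard, smul_eq_mul, mul_one]
  have hlt : ∀ R : ℂ[X], R.natDegree ≤ 2 * n →
      R.degree < (Finset.univ : Finset (Fin (n + 1) ⊕ Fin n)).card := by
    intro R hR
    refine degree_le_natDegree.trans_lt (Nat.cast_lt.2 ?_)
    simp
    omega
  have hPe : ∀ w, (∀ i, Regular t (x i) w) → P.eval w =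
      (∏ i, (1 - x i * w)) * ((∏ i, (1 - t * (x i * w))) *
        ∑ a, μ a / ((1 - x a * w) * (1 - t * (x a * w)))) := by
    intro w hw
    simp only [P, eval_finsetSum, eval_mul, eval_prod, eval_C, eval_sub, eval_one, eval_X,
      Finset.mul_sum, Finset.prod_mul_distrib]
    refine Finset.sum_congr rfl fun a _ => ?_
    obtain ⟨h1, h2⟩ := hw a
    rw [← Finset.mul_prod_erase Finset.univ (fun i => 1 - x i * w) (Finset.mem_univ a),
      ← Finset.mul_prod_erase Finset.univ (fun i => 1 - t * (x i * w)) (Finset.mem_univ a)]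
    simp only [mul_assoc t]
    generalize 1 - x a * w = A at h1 ⊢
    generalize 1 - t * (x a * w) = B at h2 ⊢
    generalize ∏ i ∈ Finset.univ.erase a, (1 - x i * w) = U
    generalize ∏ i ∈ Finset.univ.erase a, (1 - t * (x i * w)) = V
    field_simp
  have hQe : ∀ w, (∀ i, Regular t (x i) w) → Q.eval w =
      (∏ i, (1 - x i * w)) * ((∏ j, (w - y j)) * ∑ a, μ a / (1 - x a * w) * κ a) := by
    intro w hw
    simp only [Q, eval_finsetSum, eval_mul, eval_prod, eval_C, eval_sub, eval_one, eval_X,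
      Finset.mul_sum]
    refine Finset.sum_congr rfl fun a _ => ?_
    obtain ⟨h1, -⟩ := hw a
    rw [← Finset.mul_prod_erase Finset.univ (fun i => 1 - x i * w) (Finset.mem_univ a)]
    generalize 1 - x a * w = A at h1 ⊢
    field_simp
  have hPQ : P = Q := by
    refine eq_of_degrees_lt_of_eval_index_eq (s := Finset.univ)
      (v := Sum.elim (fun i => (x i)⁻¹) y) ?_ (hlt P hPd) (hlt Q hQd) ?_
    · refine Function.Injective.injOn ?_
      refine Function.Injective.sumElim (fun i j h => hx (inv_injective h)) hy fun i j h => ?_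
      apply (hxy i j).1
      rw [← h, mul_inv_cancel₀ (hx0 i), sub_self]
    · rintro (b | j) -
      · have hb := hx0 b
        have hv : ∀ a ≠ b, ∀ f : Fin (n + 1) → ℂ,
            ∏ i ∈ Finset.univ.erase a, ((1 - x i * (x b)⁻¹) * f i) = 0 := by
          intro a hab f
          refine Finset.prod_eq_zero (Finset.mem_erase.2 ⟨hab.symm, Finset.mem_univ b⟩) ?_
          rw [mul_inv_cancel₀ hb, sub_self, zero_mul]
        have hv' : ∀ a ≠ b, ∏ i ∈ Finset.univ.erase a, (1 - x i * (x b)⁻¹) = 0 := by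
          intro a hab
          simpa using hv a hab fun _ => 1
        simp only [P, Q, Sum.elim_inl, eval_finsetSum, eval_mul, eval_prod, eval_C, eval_sub,
          eval_one, eval_X]
        rw [Finset.sum_eq_single b (fun a _ hab => by rw [hv a hab, mul_zero]) (by simp),
          Finset.sum_eq_single b (fun a _ hab => by rw [hv' a hab, mul_zero]) (by simp),
          Finset.prod_mul_distrib]
        have h1 : ∏ i ∈ Finset.univ.erase b, (1 - t * x i * (x b)⁻¹) =
            (∏ i ∈ Finset.univ.erase b, (x b - t * x i)) / x b ^ n := by
          rw [show x b ^ n = ∏ _i ∈ Finset.univ.erase b, x b by rw [Finset.prod_const, hcard], ← Finset.prod_div_distrib]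
          refine Finset.prod_congr rfl fun i _ => ?_
          field_simp
        have h2 : ∏ j, ((x b)⁻¹ - y j) = (∏ j, (1 - x b * y j)) / x b ^ n := by
          rw [← Fin.prod_const n, ← Finset.prod_div_distrib]
          refine Finset.prod_congr rfl fun i _ => ?_
          field_simp
        have h3 : ∏ j, (1 - x b * y j) ≠ 0 := Finset.prod_ne_zero_iff.2 fun j _ => (hxy b j).1
        rw [h1, h2]
        simp only [κ]
        field_simp
      · rw [Sum.elim_inr, hPe _ fun i => hxy i j, hQe _ fun i => hxy i j, hμ j,
          Finset.prod_eq_zero (Finset.mem_univ j) (sub_self _)]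
        simp
  have h := (hPe z hz).symm.trans ((congrArg (eval z) hPQ).trans (hQe z hz))
  exact mul_left_cancel₀ (Finset.prod_ne_zero_iff.2 fun i _ => (hz i).1) h

theorem kernelMatrix_det_succ (t : ℂ) {n : ℕ} (x y : Fin (n + 1) → ℂ) :
    (kernelMatrix t x y).det = ∑ a : Fin (n + 1), ((-1) ^ (a : ℕ) * (1 - t) *
      (kernelMatrix t (x ∘ a.succAbove) (fun j => y j.succ)).det) /
        ((1 - x a * y 0) * (1 - t * (x a * y 0))) := by
  rw [Matrix.det_succ_column_zero]
  refine Finset.sum_congr rfl fun a _ => ?_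
  rw [show (kernelMatrix t x y).submatrix a.succAbove Fin.succ =
    kernelMatrix t (x ∘ a.succAbove) (fun j => y j.succ) from rfl]
  simp only [kernelMatrix, Matrix.of_apply]
  ring

theorem kernelSum_univ_erase (t : ℂ) {n : ℕ} (x : Fin (n + 1) → ℂ) (a : Fin (n + 1)) (l : List ℂ) :
    kernelSum t x l (Finset.univ.erase a) = kernelSum t (x ∘ a.succAbove) l Finset.univ := by
  rw [show Finset.univ.erase a = Finset.univ.map a.succAboveEmb by
    ext b
    simp [Fin.exists_succAbove_eq_iff], kernelSum_map]
  rfl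

theorem prod_erase_eq_succAbove {n : ℕ} (a : Fin (n + 1)) (f : Fin (n + 1) → ℂ) :
    ∏ i ∈ Finset.univ.erase a, f i = ∏ i : Fin n, f (a.succAbove i) := by
  rw [show Finset.univ.erase a = Finset.univ.map a.succAboveEmb by
    ext b
    simp [Fin.exists_succAbove_eq_iff], Finset.prod_map]
  rfl

theorem kernelSum_ofFn_of_ne_zero (t : ℂ) {n : ℕ} {x y : Fin n → ℂ} (hx : Function.Injective x)
    (hy : Function.Injective y) (hx0 : ∀ i, x i ≠ 0) (hxy : ∀ i j, Regular t (x i) (y j)) :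
    kernelSum t x (List.ofFn y) Finset.univ = kernelDet t x y := by
  induction n with
  | zero => simp [kernelSum, kernelDet, vprod]
  | succ n ih =>
    have hy' : Function.Injective fun j : Fin n => y j.succ :=
      hy.comp (Fin.succ_injective n)
    let d : Fin (n + 1) → ℂ := fun a => (-1) ^ (a : ℕ) * (1 - t) *
      (kernelMatrix t (x ∘ a.succAbove) (fun j => y j.succ)).det
    have hdet : ∀ w, ∑ a, d a / ((1 - x a * w) * (1 - t * (x a * w))) =
        (kernelMatrix t x (Fin.cons w fun j => y j.succ)).det := fun w => by
      rw [kernelMatrix_det_succ]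
      simp [d]
    have hvan : ∀ j : Fin n, ∑ a, d a / ((1 - x a * y j.succ) * (1 - t * (x a * y j.succ))) = 0 := by
      intro j
      rw [hdet]
      refine Matrix.det_zero_of_column_eq (i := 0) (j := j.succ) (Fin.succ_ne_zero j).symm ?_
      intro i
      simp [kernelMatrix]
    have key := kernel_interpolation t d hx hy' hx0 (fun i j => hxy i j.succ) hvan
      (z := y 0) fun i => hxy i 0
    rw [← kernelMatrix_det_succ] at key
    have hvy := vprod_ne_zero hy
    have hvx := vprod_ne_zero hx
    rw [vprod_succ, mul_ne_zero_iff] at hvy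
    rw [List.ofFn_succ, kernelSum, kernelDet, vprod_succ y]
    simp only [Fin.prod_univ_succ (fun j => 1 - t * (x _ * y j)), Finset.prod_mul_distrib]
    rw [show ∀ p q r s e : ℂ, p * q / (r * (s * e)) * (kernelMatrix t x y).det =
      q / (r * (s * e)) * (p * (kernelMatrix t x y).det) by intros; ring, key,
      ← mul_assoc, Finset.mul_sum]
    refine Finset.sum_congr rfl fun a _ => ?_
    rw [kernelSum_univ_erase, ih (hx.comp (Fin.succAbove_right_injective)) hy' (fun i => hx0 _)
      fun i j => hxy _ _, kernelDet]
    have hva := vprod_succAbove x a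
    have hva0 := hvx
    rw [hva, mul_ne_zero_iff, mul_ne_zero_iff] at hva0
    obtain ⟨⟨hs, hpx⟩, hvx'⟩ := hva0
    have hs2 : ((-1 : ℂ) ^ (a : ℕ)) * (-1) ^ (a : ℕ) = 1 := by
      rw [← mul_pow]; simp
    have hr : ∏ j : Fin n, (1 - x a * y j.succ) ≠ 0 :=
      Finset.prod_ne_zero_iff.2 fun j _ => (hxy a j.succ).1
    have hr0 : 1 - x a * y 0 ≠ 0 := (hxy a 0).1
    rw [hva, hlFactor, Finset.prod_div_distrib, prod_erase_eq_succAbove, prod_erase_eq_succAbove,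
      List.map_ofFn, List.prod_ofFn]
    simp only [Function.comp_apply, Finset.prod_div_distrib]
    rw [← Finset.mul_prod_erase Finset.univ _ (Finset.mem_univ a), prod_erase_eq_succAbove]
    obtain ⟨hv1, hv2⟩ := hvy
    simp only [d]
    generalize (∏ j : Fin n, (y 0 - y j.succ)) = Y at *
    generalize (∏ j : Fin n, (1 - x a * y j.succ)) = R at *
    generalize (∏ j : Fin n, (x a - x (a.succAbove j))) = X at *
    generalize ((-1 : ℂ) ^ (a : ℕ)) = s at *
    generalize 1 - x a * y 0 = R0 at *
    generalize (∏ i, ∏ i_1 : Fin n, (1 - t * (x (a.succAbove i) * y i_1.succ))) = A1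
    generalize (∏ i : Fin n, (1 - t * (x a * y i.succ))) = A2
    generalize (∏ i, (x a - t * x (a.succAbove i))) = A3
    field_simp

section Continuity

open Filter Topology

variable {α ι κ : Type*} {F : Filter α} {X : α → ι → ℂ} {x : ι → ℂ}
  {Y : α → κ → ℂ} {y : κ → ℂ}

theorem tendsto_hlFactor (t : ℂ) {a : ι} {K : Finset ι}
    (ha : Tendsto (fun s => X s a) F (𝓝 (x a))) (hK : ∀ b ∈ K, Tendsto (fun s => X s b) F (𝓝 (x b)))
    (hx : ∀ b ∈ K, x a ≠ x b) :
    Tendsto (fun s => hlFactor t (X s) a K) F (𝓝 (hlFactor t x a K)) :=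
  tendsto_finsetProd _ fun b hb =>
    (ha.sub ((hK b hb).const_mul t)).div (ha.sub (hK b hb)) (sub_ne_zero.2 (hx b hb))

theorem tendsto_translate (x : ι → ℂ) (a : ι) :
    Tendsto (fun ε : ℂ => x a + ε) (𝓝[≠] 0) (𝓝 (x a)) := by
  have : Tendsto (fun ε : ℂ => x a + ε) (𝓝 0) (𝓝 (x a + 0)) :=
    (continuous_const.add continuous_id).tendsto 0
  rw [add_zero] at this
  exact this.mono_left nhdsWithin_le_nhds

/-- Translating finitely many complex numbers by a small nonzero amount makes them nonzero and
preserves regularity. -/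
theorem eventually_translate_regular (t : ℂ) (x : ι → ℂ) (y : κ → ℂ) (S : Finset ι) (T : Finset κ)
    (hr : ∀ a ∈ S, ∀ c ∈ T, Regular t (x a) (y c)) :
    ∀ᶠ ε in 𝓝[≠] (0 : ℂ), (∀ a ∈ S, x a + ε ≠ 0) ∧
      ∀ a ∈ S, ∀ c ∈ T, Regular t (x a + ε) (y c) := by
  have h0 := tendsto_translate x
  refine ((Finset.eventually_all S).2 fun a _ => ?_).and
    ((Finset.eventually_all S).2 fun a ha => (Finset.eventually_all T).2 fun c hc => ?_)
  · rcases eq_or_ne (x a) 0 with h | h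
    · filter_upwards [self_mem_nhdsWithin] with ε hε
      simpa [h] using hε
    · exact (h0 a).eventually_ne h
  · refine (Tendsto.eventually_ne ?_ (hr a ha c hc).1).and
      (Tendsto.eventually_ne ?_ (hr a ha c hc).2)
    · exact tendsto_const_nhds.sub ((h0 a).mul_const _)
    · exact tendsto_const_nhds.sub (((h0 a).mul_const _).const_mul t)

variable [DecidableEq ι]

theorem tendsto_hlWeight (t : ℂ) {I S : Finset ι} (hI : I ⊆ S)
    (hS : ∀ b ∈ S, Tendsto (fun s => X s b) F (𝓝 (x b))) (hx : Set.InjOn x S) :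
    Tendsto (fun s => hlWeight t (X s) I (S \ I)) F (𝓝 (hlWeight t x I (S \ I))) := by
  refine tendsto_finsetProd _ fun a ha => tendsto_hlFactor t (hS a (hI ha))
    (fun b hb => hS b (Finset.mem_sdiff.1 hb).1) fun b hb h => ?_
  rw [Finset.mem_sdiff] at hb
  exact hb.2 (hx (hI ha) hb.1 h ▸ ha)

theorem tendsto_kernelSum (t : ℂ) {S : Finset ι} {l : List κ}
    (hX : ∀ a ∈ S, Tendsto (fun s => X s a) F (𝓝 (x a)))
    (hY : ∀ c ∈ l, Tendsto (fun s => Y s c) F (𝓝 (y c))) (hx : Set.InjOn x S)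
    (hr : ∀ a ∈ S, ∀ c ∈ l, 1 - x a * y c ≠ 0) :
    Tendsto (fun s => kernelSum t (X s) (l.map (Y s)) S) F (𝓝 (kernelSum t x (l.map y) S)) := by
  induction l generalizing S with
  | nil => simpa [kernelSum] using tendsto_const_nhds
  | cons z l ih =>
    simp only [List.map_cons, kernelSum, List.map_map]
    refine tendsto_finsetSum _ fun a ha => ((Tendsto.mul ?_ ?_).mul ?_).mul ?_
    · exact tendsto_const_nhds.div (tendsto_const_nhds.sub ((hX a ha).mul (hY z (by simp))))
        (hr a ha z (by simp))
    · refine tendsto_list_prod _ fun c hc => ?_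
      have hac := (hX a ha).mul (hY c (by simp [hc]))
      exact (tendsto_const_nhds.sub (hac.const_mul t)).div (tendsto_const_nhds.sub hac)
        (hr a ha c (by simp [hc]))
    · refine tendsto_hlFactor t (hX a ha) (fun b hb => hX b (Finset.mem_of_mem_erase hb)) ?_
      exact fun b hb h => Finset.ne_of_mem_erase hb (hx ha (Finset.mem_of_mem_erase hb) h).symm
    · exact ih (fun b hb => hX b (Finset.mem_of_mem_erase hb)) (fun c hc => hY c (by simp [hc]))
        (hx.mono (by simp)) fun b hb c hc => hr b (Finset.mem_of_mem_erase hb) c (by simp [hc])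

theorem kernelSum_ofFn (t : ℂ) {n : ℕ} {x y : Fin n → ℂ} (hx : Function.Injective x)
    (hy : Function.Injective y) (hr : ∀ i j, Regular t (x i) (y j)) :
    kernelSum t x (List.ofFn y) Finset.univ = kernelDet t x y := by
  have hX := tendsto_translate x
  have h1 : Tendsto (fun ε : ℂ => kernelSum t (fun i => x i + ε) (List.ofFn y) Finset.univ)
      (𝓝[≠] 0) (𝓝 (kernelSum t x (List.ofFn y) Finset.univ)) := by
    rw [List.ofFn_eq_map]
    exact tendsto_kernelSum t (fun a _ => hX a) (fun c _ => tendsto_const_nhds) hx.injOn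
      fun a _ c _ => (hr a c).1
  have hv : Tendsto (fun ε : ℂ => vprod fun i => x i + ε) (𝓝[≠] 0) (𝓝 (vprod x)) :=
    tendsto_finsetProd _ fun i _ => tendsto_finsetProd _ fun j _ => (hX i).sub (hX j)
  have hM : Tendsto (fun ε : ℂ => kernelMatrix t (fun i => x i + ε) y) (𝓝[≠] 0)
      (𝓝 (kernelMatrix t x y)) := by
    refine tendsto_pi_nhds.2 fun i => tendsto_pi_nhds.2 fun j => ?_
    have hij := (hX i).mul_const (y j)
    exact tendsto_const_nhds.div ((tendsto_const_nhds.sub hij).mul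
      (tendsto_const_nhds.sub (hij.const_mul t))) (mul_ne_zero (hr i j).1 (hr i j).2)
  have h2 : Tendsto (fun ε : ℂ => kernelDet t (fun i => x i + ε) y) (𝓝[≠] 0)
      (𝓝 (kernelDet t x y)) := by
    refine (Tendsto.div ?_ (hv.mul_const _) (mul_ne_zero (vprod_ne_zero hx) (vprod_ne_zero hy))).mul
      ((Continuous.matrix_det continuous_id).continuousAt.tendsto.comp hM)
    exact tendsto_finsetProd _ fun i _ => tendsto_finsetProd _ fun j _ =>
      tendsto_const_nhds.sub (((hX i).mul_const _).const_mul t)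
  refine tendsto_nhds_unique_of_eventuallyEq h1 h2 ?_
  filter_upwards [eventually_translate_regular t x y Finset.univ Finset.univ
    fun a _ c _ => hr a c] with ε hε
  exact kernelSum_ofFn_of_ne_zero t (fun i j h => hx (by simpa using h)) hy
    (fun i => hε.1 i (Finset.mem_univ _)) fun i j => hε.2 i (Finset.mem_univ _) j
      (Finset.mem_univ _)

theorem kernelSum_swap (t : ℂ) {x : ι → ℂ} (z w : ℂ) (l : List ℂ) {S : Finset ι}
    (hS : S.card = l.length + 2) (hx : Set.InjOn x S) (hl : (z :: w :: l).Nodup)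
    (hr : ∀ a ∈ S, ∀ c ∈ z :: w :: l, Regular t (x a) c) :
    kernelSum t x (w :: z :: l) S = kernelSum t x (z :: w :: l) S := by
  let e : Fin (l.length + 2) ↪ ι :=
    (S.equivFinOfCardEq hS).symm.toEmbedding.trans (Function.Embedding.subtype _)
  have he : Finset.univ.map e = S := by
    rw [← Finset.map_map, Finset.map_univ_equiv, Finset.univ_eq_attach, Finset.attach_map_val]
  have hxe : Function.Injective (x ∘ e) := fun i j h =>
    e.injective (hx (he ▸ by simp) (he ▸ by simp) h)
  have key : ∀ l' : List ℂ, ∀ y : Fin (l.length + 2) → ℂ, List.ofFn y = l' → l'.Nodup →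
      (∀ c ∈ l', c ∈ z :: w :: l) → kernelSum t x l' S = kernelDet t (x ∘ e) y := by
    rintro _ y rfl h1 h2
    rw [← he, kernelSum_map, kernelSum_ofFn t hxe (List.nodup_ofFn.1 h1)]
    exact fun i j => hr _ (he ▸ by simp) _ (h2 _ ((List.mem_ofFn' _ _).2 ⟨j, rfl⟩))
  let y : Fin (l.length + 2) → ℂ := (z :: w :: l).get
  have hy : List.ofFn y = z :: w :: l := List.ofFn_get _
  have hy' : List.ofFn (y ∘ Equiv.swap 0 1) = w :: z :: l := by
    have h2 : ∀ i : Fin l.length, Equiv.swap (0 : Fin (l.length + 2)) 1 i.succ.succ = i.succ.succ :=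
      fun i => Equiv.swap_apply_of_ne_of_ne (Fin.succ_ne_zero _)
        (by rw [← Fin.succ_zero_eq_one]; exact (Fin.succ_injective _).ne (Fin.succ_ne_zero _))
    rw [List.ofFn_succ, List.ofFn_succ]
    simp only [Function.comp_apply, h2, Fin.succ_zero_eq_one, Equiv.swap_apply_left,
      Equiv.swap_apply_right]
    have : (List.ofFn fun i : Fin l.length => y i.succ.succ) = l := List.ofFn_get l
    rw [this]
    rfl
  rw [key _ _ hy hl fun _ h => h, key _ _ hy' ((List.Perm.swap w z l).nodup_iff.1 hl) (by
    intro c hc; simp only [List.mem_cons] at hc ⊢; tauto), kernelDet_comp_perm]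

theorem kernelSum_perm (t : ℂ) {x : ι → ℂ} {l l' : List ℂ} (h : l.Perm l') {S : Finset ι}
    (hS : S.card = l.length) (hx : Set.InjOn x S) (hl : l.Nodup)
    (hr : ∀ a ∈ S, ∀ c ∈ l, Regular t (x a) c) : kernelSum t x l S = kernelSum t x l' S := by
  induction h generalizing S with
  | nil => rfl
  | cons z h ih =>
    rw [kernelSum, kernelSum]
    refine Finset.sum_congr rfl fun a ha => ?_
    rw [(h.map _).prod_eq, ih (by rw [Finset.card_erase_of_mem ha, hS]; rfl) (hx.mono (by simp))
      (List.nodup_cons.1 hl).2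
      fun b hb c hc => hr b (Finset.mem_of_mem_erase hb) c (List.mem_cons_of_mem _ hc)]
  | swap z w l =>
    exact (kernelSum_swap t w z l hS hx hl hr).symm
  | trans h₁ h₂ ih₁ ih₂ =>
    rw [ih₁ hS hx hl hr, ih₂ (hS.trans h₁.length_eq) hx (h₁.nodup_iff.1 hl)
      fun a ha c hc => hr a ha c (h₁.mem_iff.2 hc)]

end Continuity

section SimplePoles

open Filter Topology Polynomial

/-- `f` agrees off `P` with a rational function that is bounded at infinity and has at most simple
poles, all of them in `P`. -/
def HasSimplePoles (P : Finset ℂ) (f : ℂ → ℂ) : Prop :=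
  ∃ Q : ℂ[X], Q.natDegree ≤ P.card ∧ ∀ z ∉ P, f z = Q.eval z / ∏ p ∈ P, (z - p)

namespace HasSimplePoles

variable {P R : Finset ℂ} {f g : ℂ → ℂ}

theorem prod_sub_ne_zero {z : ℂ} (hz : z ∉ P) : ∏ p ∈ P, (z - p) ≠ 0 :=
  Finset.prod_ne_zero_iff.2 fun _ hp => sub_ne_zero.2 fun h => hz (h ▸ hp)

theorem const (P : Finset ℂ) (c : ℂ) : HasSimplePoles P fun _ => c := by
  refine ⟨C c * ∏ p ∈ P, (X - C p), ?_, fun z hz => ?_⟩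
  · refine (natDegree_C_mul_le _ _).trans ?_
    rw [natDegree_prod_of_monic _ _ fun p _ => monic_X_sub_C _]
    simp
  · simp only [eval_mul, eval_C, eval_prod, eval_sub, eval_X]
    rw [mul_div_cancel_right₀ _ (prod_sub_ne_zero hz)]

theorem congr (hf : HasSimplePoles P f) (h : ∀ z ∉ P, g z = f z) : HasSimplePoles P g := by
  obtain ⟨Q, hd, hQ⟩ := hf
  exact ⟨Q, hd, fun z hz => (h z hz).trans (hQ z hz)⟩

theorem add (hf : HasSimplePoles P f) (hg : HasSimplePoles P g) :
    HasSimplePoles P fun z => f z + g z := by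
  obtain ⟨Q, hd, hQ⟩ := hf
  obtain ⟨Q', hd', hQ'⟩ := hg
  refine ⟨Q + Q', (natDegree_add_le _ _).trans (max_le hd hd'), fun z hz => ?_⟩
  simp only [hQ z hz, hQ' z hz, eval_add, add_div]

theorem const_mul (c : ℂ) (hf : HasSimplePoles P f) : HasSimplePoles P fun z => c * f z := by
  obtain ⟨Q, hd, hQ⟩ := hf
  refine ⟨C c * Q, (natDegree_C_mul_le _ _).trans hd, fun z hz => ?_⟩
  simp only [hQ z hz, eval_mul, eval_C, mul_div_assoc]

theorem sum {β : Type*} {s : Finset β} {F : β → ℂ → ℂ} (h : ∀ i ∈ s, HasSimplePoles P (F i)) :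
    HasSimplePoles P fun z => ∑ i ∈ s, F i z := by
  classical
  induction s using Finset.induction_on with
  | empty => simpa using const P 0
  | insert i s hi ih =>
    simp only [Finset.sum_insert hi]
    exact (h i (by simp)).add (ih fun j hj => h j (by simp [hj]))

theorem mul (hf : HasSimplePoles P f) (hg : HasSimplePoles R g) (hd : Disjoint P R) :
    HasSimplePoles (P ∪ R) fun z => f z * g z := by
  obtain ⟨Q, hQd, hQ⟩ := hf
  obtain ⟨Q', hQd', hQ'⟩ := hg
  refine ⟨Q * Q', ?_, fun z hz => ?_⟩
  · rw [Finset.card_union_of_disjoint hd]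
    exact natDegree_mul_le.trans (add_le_add hQd hQd')
  · rw [Finset.mem_union, not_or] at hz
    simp only [hQ z hz.1, hQ' z hz.2, eval_mul, Finset.prod_union hd, div_mul_div_comm]

theorem mono (hf : HasSimplePoles P f) (h : P ⊆ R) : HasSimplePoles R f := by
  have := hf.mul (const (R \ P) 1) Finset.disjoint_sdiff
  simpa [Finset.union_sdiff_of_subset h] using this

theorem linear_div (a b q : ℂ) : HasSimplePoles {q} fun z => (a + b * z) / (z - q) := by
  refine ⟨C a + C b * X, ?_, fun z _ => by simp⟩
  compute_degree!

theorem prod {β : Type*} {s : Finset β} {F : β → ℂ → ℂ} {q : β → ℂ} (hq : Set.InjOn q s)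
    (h : ∀ i ∈ s, HasSimplePoles {q i} (F i)) :
    HasSimplePoles (s.image q) fun z => ∏ i ∈ s, F i z := by
  classical
  induction s using Finset.induction_on with
  | empty => simpa using const ∅ 1
  | insert i s hi ih =>
    simp only [Finset.prod_insert hi, Finset.image_insert]
    rw [Finset.insert_eq]
    refine (h i (by simp)).mul (ih (hq.mono (by simp)) fun j hj => h j (by simp [hj])) ?_
    rw [Finset.disjoint_singleton_left, Finset.mem_image]
    rintro ⟨j, hj, hji⟩
    exact hi (hq (by simp [hj]) (by simp) hji ▸ hj)

/-- A rational function bounded at infinity and without poles is constant. -/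
theorem eq_of_residues (hf : HasSimplePoles P f)
    (hr : ∀ p ∈ P, Tendsto (fun z => (z - p) * f z) (𝓝[≠] p) (𝓝 0)) {z w : ℂ} (hz : z ∉ P)
    (hw : w ∉ P) : f z = f w := by
  obtain ⟨Q, hd, hQ⟩ := hf
  have hroot : ∀ p ∈ P, Q.eval p = 0 := by
    intro p hp
    have h1 : Tendsto (fun z => ((z - p) * f z) * ∏ q ∈ P.erase p, (z - q)) (𝓝[≠] p)
        (𝓝 (0 * ∏ q ∈ P.erase p, (p - q))) :=
      (hr p hp).mul (tendsto_finsetProd _ fun q _ =>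
        (tendsto_id.mono_left nhdsWithin_le_nhds).sub tendsto_const_nhds)
    rw [zero_mul] at h1
    have h2 : Tendsto (fun z => Q.eval z) (𝓝[≠] p) (𝓝 (Q.eval p)) :=
      (Q.continuous.tendsto p).mono_left nhdsWithin_le_nhds
    refine tendsto_nhds_unique_of_eventuallyEq h2 h1 ?_
    have h3 : ∀ᶠ z in 𝓝[≠] p, z ∉ P.erase p :=
      nhdsWithin_le_nhds ((P.erase p).finite_toSet.isClosed.isOpen_compl.mem_nhds
        (by simp : p ∈ ((P.erase p : Finset ℂ) : Set ℂ)ᶜ))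
    filter_upwards [self_mem_nhdsWithin, h3] with v hv hvP
    have hv' : v ∉ P := fun h => hvP (Finset.mem_erase.2 ⟨hv, h⟩)
    rw [hQ v hv', ← Finset.mul_prod_erase P _ hp]
    have := prod_sub_ne_zero hvP
    have := sub_ne_zero.2 (show v ≠ p from hv)
    field_simp
  have hdvd : ∏ p ∈ P, (X - C p) ∣ Q := by
    refine Finset.prod_dvd_of_coprime (fun p _ q _ hpq => ?_) fun p hp =>
      dvd_iff_isRoot.2 (hroot p hp)
    exact pairwise_coprime_X_sub_C Function.injective_id hpq
  obtain ⟨U, hU⟩ := hdvd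
  have hm : (∏ p ∈ P, (X - C p)).Monic := monic_prod_of_monic _ _ fun p _ => monic_X_sub_C _
  have hU0 : U.natDegree = 0 := by
    rcases eq_or_ne U 0 with rfl | h0
    · simp
    · rw [hU, hm.natDegree_mul' h0, natDegree_prod_of_monic _ _ fun p _ => monic_X_sub_C _] at hd
      simpa using hd
  rw [eq_C_of_natDegree_eq_zero hU0] at hU
  have key : ∀ v ∉ P, f v = U.coeff 0 := fun v hv => by
    rw [hQ v hv, hU]
    simp only [eval_mul, eval_C, eval_prod, eval_sub, eval_X]
    rw [mul_div_cancel_left₀ _ (prod_sub_ne_zero hv)]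
  rw [key z hz, key w hw]

end HasSimplePoles

end SimplePoles

section Recursion

open Filter Topology

variable {ι κ : Type*}

/-- The variables are pairwise distinct and avoid the poles of the kernel. -/
structure GenericOn (t : ℂ) (x : ι → ℂ) (y : κ → ℂ) (S : Finset ι) (T : Finset κ) : Prop where
  left : Set.InjOn x S
  right : Set.InjOn y T
  regular : ∀ a ∈ S, ∀ c ∈ T, Regular t (x a) (y c)

theorem GenericOn.mono {t : ℂ} {x : ι → ℂ} {y : κ → ℂ} {S I : Finset ι} {T J : Finset κ}
    (h : GenericOn t x y S T) (hI : I ⊆ S) (hJ : J ⊆ T) : GenericOn t x y I J :=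
  ⟨h.left.mono (Finset.coe_subset.2 hI), h.right.mono (Finset.coe_subset.2 hJ),
    fun a ha c hc => h.regular a (hI ha) c (hJ hc)⟩

variable [DecidableEq ι]

/-- `kernelSum` with the second set of variables indexed by a finite set. -/
def kernelSet (t : ℂ) (x : ι → ℂ) (y : κ → ℂ) (I : Finset ι) (J : Finset κ) : ℂ :=
  kernelSum t x (J.toList.map y) I

/-- The coefficient of `(1 - t) / (1 - x_a z)` in `kernelCons`. -/
def kernelCoeff (t : ℂ) (x : ι → ℂ) (y : κ → ℂ) (I : Finset ι) (J : Finset κ) (a : ι) : ℂ :=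
  (∏ c ∈ J, (1 - t * (x a * y c)) / (1 - x a * y c)) * hlFactor t x a (I.erase a) *
    kernelSet t x y (I.erase a) J

/-- The kernel in the variables `x_a`, `a ∈ I`, and `z`, `y_c`, `c ∈ J`. -/
def kernelCons (t : ℂ) (x : ι → ℂ) (y : κ → ℂ) (I : Finset ι) (J : Finset κ) (z : ℂ) : ℂ :=
  ∑ a ∈ I, (1 - t) / (1 - x a * z) * kernelCoeff t x y I J a

theorem kernelSet_congr (t : ℂ) (x : ι → ℂ) {y y' : κ → ℂ} (I : Finset ι) {J : Finset κ}
    (h : ∀ c ∈ J, y c = y' c) : kernelSet t x y I J = kernelSet t x y' I J := by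
  rw [kernelSet, kernelSet, List.map_congr_left fun c hc => h c (Finset.mem_toList.1 hc)]

theorem kernelSum_cons_eq (t : ℂ) (x : ι → ℂ) (y : κ → ℂ) (I : Finset ι) (J : Finset κ) (z : ℂ) :
    kernelSum t x (z :: J.toList.map y) I = kernelCons t x y I J z := by
  rw [kernelSum, kernelCons]
  refine Finset.sum_congr rfl fun a _ => ?_
  rw [kernelCoeff, kernelSet, List.map_map, ← Finset.prod_map_toList]
  simp only [Function.comp_def]
  ring

theorem continuousAt_kernelCons (t : ℂ) {x : ι → ℂ} (y : κ → ℂ) {I : Finset ι} (J : Finset κ)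
    {p : ℂ} (h : ∀ a ∈ I, 1 - x a * p ≠ 0) : ContinuousAt (kernelCons t x y I J) p :=
  tendsto_finsetSum _ fun a ha => (tendsto_const_nhds.div
    (tendsto_const_nhds.sub (tendsto_id.const_mul (x a))) (h a ha)).mul tendsto_const_nhds

theorem tendsto_prod_sub_div (t : ℂ) {y : κ → ℂ} {K : Finset κ} {p : ℂ} (h : ∀ c ∈ K, p ≠ y c) :
    Tendsto (fun z => ∏ c ∈ K, (z - t * y c) / (z - y c)) (𝓝 p)
      (𝓝 (∏ c ∈ K, (p - t * y c) / (p - y c))) :=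
  tendsto_finsetProd _ fun c hc => (tendsto_id.sub tendsto_const_nhds).div
    (tendsto_id.sub tendsto_const_nhds) (sub_ne_zero.2 (h c hc))

theorem tendsto_sub_mul_of_continuousAt {f : ℂ → ℂ} {p : ℂ} (hf : ContinuousAt f p) :
    Tendsto (fun z => (z - p) * f z) (𝓝[≠] p) (𝓝 0) := by
  have h : Tendsto (fun z => (z - p) * f z) (𝓝 p) (𝓝 ((p - p) * f p)) :=
    (tendsto_id.sub tendsto_const_nhds).mul hf
  rw [sub_self, zero_mul] at h
  exact h.mono_left nhdsWithin_le_nhds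

theorem tendsto_kernelCons_pole (t : ℂ) {x : ι → ℂ} (y : κ → ℂ) {I : Finset ι} (J : Finset κ)
    {a : ι} (ha : a ∉ I) (hx : Set.InjOn x (insert a I : Finset ι)) (h0 : x a ≠ 0) :
    Tendsto (fun z => (z - (x a)⁻¹) * kernelCons t x y (insert a I) J z) (𝓝[≠] (x a)⁻¹)
      (𝓝 (-((1 - t) / x a) * ((∏ c ∈ J, (1 - t * (x a * y c)) / (1 - x a * y c)) *
        hlFactor t x a I * kernelSet t x y I J))) := by
  have hne : ∀ b ∈ I, 1 - x b * (x a)⁻¹ ≠ 0 := fun b hb h => by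
    have hab : x b = x a := by
      field_simp at h
      linear_combination -h
    exact ha (hx (by simp [hb]) (by simp) hab ▸ hb)
  have h1 : Tendsto (fun z => (z - (x a)⁻¹) * ((1 - t) / (1 - x a * z))) (𝓝[≠] (x a)⁻¹)
      (𝓝 (-((1 - t) / x a))) := by
    refine tendsto_const_nhds.congr' ?_
    filter_upwards [self_mem_nhdsWithin] with z hz
    have hz' := sub_ne_zero.2 (show z ≠ (x a)⁻¹ from hz)
    rw [show 1 - x a * z = -x a * (z - (x a)⁻¹) by field_simp; ring]
    generalize z - (x a)⁻¹ = w at hz'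
    field_simp
  have h2 : Tendsto (fun z => (z - (x a)⁻¹) *
      ∑ b ∈ I, (1 - t) / (1 - x b * z) * kernelCoeff t x y (insert a I) J b) (𝓝[≠] (x a)⁻¹)
      (𝓝 0) := by
    refine tendsto_sub_mul_of_continuousAt ?_
    exact tendsto_finsetSum _ fun b hb => (tendsto_const_nhds.div
      (tendsto_const_nhds.sub (tendsto_id.const_mul (x b))) (hne b hb)).mul tendsto_const_nhds
  have h3 := (h1.mul_const (kernelCoeff t x y (insert a I) J a)).add h2
  rw [add_zero, kernelCoeff, Finset.erase_insert ha] at h3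
  refine h3.congr fun z => ?_
  rw [kernelCons, Finset.sum_insert ha, kernelCoeff, Finset.erase_insert ha]
  ring

variable [DecidableEq κ]

theorem kernelSet_insert {t : ℂ} {x : ι → ℂ} {y : κ → ℂ} {I : Finset ι} {J : Finset κ} {b : κ}
    (h : GenericOn t x y I (insert b J)) (hb : b ∉ J) (hc : I.card = J.card + 1) :
    kernelSet t x y I (insert b J) = kernelCons t x y I J (y b) := by
  rw [← kernelSum_cons_eq, kernelSet]
  refine kernelSum_perm t ((Finset.toList_insert hb).map y) ?_ h.left ?_ ?_
  · rw [List.length_map, Finset.length_toList, Finset.card_insert_of_notMem hb, hc]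
  · refine List.Nodup.map_on (fun a ha c hc hac => ?_) (Finset.nodup_toList _)
    exact h.right (by simpa using ha) (by simpa using hc) hac
  · intro a ha c hc
    obtain ⟨d, hd, rfl⟩ := List.mem_map.1 hc
    exact h.regular a ha d (Finset.mem_toList.1 hd)

/-- The coefficient of the kernel `kernelSet t x y I J` in the recursion. -/
def recCoeff (t : ℂ) (x : ι → ℂ) (y : κ → ℂ) (S : Finset ι) (T : Finset κ) (I : Finset ι)
    (J : Finset κ) : ℂ :=
  qfac t (S.card - I.card) * (∏ a ∈ I, x a) * (∏ c ∈ J, y c) * hlWeight t x I (S \ I) *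
    hlWeight t y J (T \ J)

/-- The sum over pairs of subsets of the same cardinality, which turns out to be equal to the kernel
`kernelSet t x y S T`. -/
def recSum (t : ℂ) (x : ι → ℂ) (y : κ → ℂ) (S : Finset ι) (T : Finset κ) : ℂ :=
  ∑ I ∈ S.powerset, ∑ J ∈ T.powerset,
    if I.card = J.card then recCoeff t x y S T I J * kernelSet t x y I J else 0

/-- The part of the summand of `recSum` over `insert b T` with `b ∉ J`, as a function of
`z = y b`. -/
def recTermA (t : ℂ) (x : ι → ℂ) (y : κ → ℂ) (S : Finset ι) (T : Finset κ) (I : Finset ι)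
    (J : Finset κ) (z : ℂ) : ℂ :=
  if I.card = J.card then
    recCoeff t x y S T I J * kernelSet t x y I J * ∏ c ∈ J, (y c - t * z) / (y c - z) else 0

/-- The part of the summand of `recSum` over `insert b T` with second subset `insert b J`, as a
function of `z = y b`. -/
def recTermB (t : ℂ) (x : ι → ℂ) (y : κ → ℂ) (S : Finset ι) (T : Finset κ) (I : Finset ι)
    (J : Finset κ) (z : ℂ) : ℂ :=
  if I.card = J.card + 1 then
    recCoeff t x y S T I J * ((z * kernelCons t x y I J z) *
      ∏ c ∈ T \ J, (z - t * y c) / (z - y c)) else 0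

/-- The difference of the two sides of the recursion, as a function of one of the variables. -/
def recDefect (t : ℂ) (x : ι → ℂ) (y : κ → ℂ) (S : Finset ι) (T : Finset κ) (z : ℂ) : ℂ :=
  ∑ I ∈ S.powerset, ∑ J ∈ T.powerset, (recTermA t x y S T I J z + recTermB t x y S T I J z) -
    kernelCons t x y S T z

theorem recSum_sub_kernelSet {t : ℂ} {x : ι → ℂ} {y : κ → ℂ} {S : Finset ι} {T : Finset κ} {b : κ}
    (h : GenericOn t x y S (insert b T)) (hb : b ∉ T) (hc : S.card = T.card + 1) :
    recSum t x y S (insert b T) - kernelSet t x y S (insert b T) = recDefect t x y S T (y b) := by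
  rw [recDefect, kernelSet_insert h hb hc, recSum]
  congr 1
  refine Finset.sum_congr rfl fun I hI => ?_
  rw [Finset.mem_powerset] at hI
  rw [Finset.sum_powerset_insert hb, ← Finset.sum_add_distrib]
  refine Finset.sum_congr rfl fun J hJ => ?_
  rw [Finset.mem_powerset] at hJ
  have hbJ : b ∉ J := fun h => hb (hJ h)
  congr 1
  · rw [recTermA]
    refine if_congr Iff.rfl ?_ rfl
    rw [recCoeff, recCoeff, Finset.insert_sdiff_of_notMem _ hbJ,
      hlWeight_insert_right t y J fun h => hb (Finset.mem_sdiff.1 h).1]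
    ring
  · rw [recTermB, Finset.card_insert_of_notMem hbJ]
    split_ifs with hIJ
    · rw [kernelSet_insert (h.mono hI (Finset.insert_subset_insert _ hJ)) hbJ hIJ, recCoeff,
        recCoeff, Finset.insert_sdiff_insert, Finset.sdiff_insert_of_notMem hb,
        hlWeight_insert_left t y _ hbJ, Finset.prod_insert hbJ, hlFactor]
      ring
    · rfl

theorem recDefect_congr (t : ℂ) (x : ι → ℂ) {y y' : κ → ℂ} (S : Finset ι) {T : Finset κ}
    (h : ∀ c ∈ T, y c = y' c) : recDefect t x y S T = recDefect t x y' S T := by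
  have hcons : ∀ I, ∀ J ⊆ T, kernelCons t x y I J = kernelCons t x y' I J := by
    intro I J hJ
    funext z
    simp only [kernelCons, kernelCoeff]
    refine Finset.sum_congr rfl fun a _ => ?_
    rw [kernelSet_congr t x _ fun c hc => h c (hJ hc),
      Finset.prod_congr rfl fun c hc => by rw [h c (hJ hc)]]
  have hcoeff : ∀ I, ∀ J ⊆ T, recCoeff t x y S T I J = recCoeff t x y' S T I J := by
    intro I J hJ
    have hw : hlWeight t y J (T \ J) = hlWeight t y' J (T \ J) :=
      Finset.prod_congr rfl fun a ha => Finset.prod_congr rfl fun b hb => by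
        rw [h a (hJ ha), h b (Finset.mem_sdiff.1 hb).1]
    rw [recCoeff, recCoeff, hw, Finset.prod_congr rfl fun c hc => h c (hJ hc)]
  funext z
  rw [recDefect, recDefect, hcons S T subset_rfl]
  congr 1
  refine Finset.sum_congr rfl fun I _ => Finset.sum_congr rfl fun J hJ => ?_
  rw [Finset.mem_powerset] at hJ
  rw [recTermA, recTermA, recTermB, recTermB, hcons I J hJ, hcoeff I J hJ,
    kernelSet_congr t x _ fun c hc => h c (hJ hc),
    Finset.prod_congr rfl fun c hc => by rw [h c (hJ hc)],
    Finset.prod_congr (s₁ := T \ J) rfl fun c hc => by rw [h c (Finset.mem_sdiff.1 hc).1]]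

theorem hasSimplePoles_recDefect (t : ℂ) {x : ι → ℂ} {y : κ → ℂ} {S : Finset ι} {T : Finset κ}
    (h : GenericOn t x y S T) (hx : ∀ a ∈ S, x a ≠ 0) :
    HasSimplePoles (S.image (fun a => (x a)⁻¹) ∪ T.image y) (recDefect t x y S T) := by
  have hpole : ∀ a ∈ S, ∀ z, 1 - x a * z = -x a * (z - (x a)⁻¹) := fun a ha z => by
    have := hx a ha
    field_simp
    ring
  have hcons : ∀ u v : ℂ, ∀ I ⊆ S, ∀ J, HasSimplePoles (S.image fun a => (x a)⁻¹)
      fun z => (u + v * z) * kernelCons t x y I J z := by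
    intro u v I hI J
    simp only [kernelCons, Finset.mul_sum]
    refine HasSimplePoles.sum fun a ha => ?_
    have h1 := (HasSimplePoles.linear_div u v (x a)⁻¹).const_mul
      ((1 - t) * kernelCoeff t x y I J a / -x a)
    refine (h1.mono (R := S.image fun a => (x a)⁻¹) ?_).congr fun z _ => ?_
    · exact Finset.singleton_subset_iff.2 (Finset.mem_image_of_mem _ (hI ha))
    · rw [hpole a (hI ha)]
      simp only [div_eq_mul_inv, mul_inv]
      ring
  have hdisj : ∀ K ⊆ T, Disjoint (S.image fun a => (x a)⁻¹) (K.image y) := by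
    intro K hK
    refine Finset.disjoint_left.2 fun p hp hp' => ?_
    obtain ⟨a, ha, rfl⟩ := Finset.mem_image.1 hp
    obtain ⟨c, hc, hac⟩ := Finset.mem_image.1 hp'
    refine (h.regular a ha c (hK hc)).1 ?_
    rw [hac, mul_inv_cancel₀ (hx a ha), sub_self]
  have hlin : HasSimplePoles (S.image (fun a => (x a)⁻¹) ∪ T.image y)
      fun z => -1 * kernelCons t x y S T z := by
    have := (hcons (-1) 0 S subset_rfl T).mono (R := S.image (fun a => (x a)⁻¹) ∪ T.image y)
      Finset.subset_union_left
    simpa using this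
  refine HasSimplePoles.congr (HasSimplePoles.add (HasSimplePoles.sum fun I hI =>
    HasSimplePoles.sum (s := T.powerset) fun J hJ =>
      HasSimplePoles.add (f := fun z => recTermA t x y S T I J z)
        (g := fun z => recTermB t x y S T I J z) ?_ ?_) hlin)
      fun z _ => by rw [recDefect]; ring
  · rw [Finset.mem_powerset] at hJ
    by_cases hc : I.card = J.card
    · simp only [recTermA, if_pos hc]
      refine (HasSimplePoles.mono (P := J.image y) ?_ ?_).const_mul _
      · refine HasSimplePoles.prod (h.right.mono (Finset.coe_subset.2 hJ)) fun c _ =>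
          (HasSimplePoles.linear_div (-y c) t (y c)).congr fun z _ => ?_
        rw [← neg_div_neg_eq]
        ring
      · exact (Finset.image_subset_image hJ).trans Finset.subset_union_right
    · simpa only [recTermA, if_neg hc] using HasSimplePoles.const _ 0
  · rw [Finset.mem_powerset] at hI
    by_cases hc : I.card = J.card + 1
    · simp only [recTermB, if_pos hc]
      refine HasSimplePoles.const_mul _ ((HasSimplePoles.mul (R := (T \ J).image y)
        (by simpa using hcons 0 1 I hI J) ?_ (hdisj _ Finset.sdiff_subset)).mono ?_)
      · refine HasSimplePoles.prod (h.right.mono (Finset.coe_subset.2 Finset.sdiff_subset))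
          fun c _ => (HasSimplePoles.linear_div (-(t * y c)) 1 (y c)).congr fun z _ => ?_
        ring
      · exact Finset.union_subset_union_right (Finset.image_subset_image Finset.sdiff_subset)
    · simpa only [recTermB, if_neg hc] using HasSimplePoles.const _ 0

theorem continuousAt_recTermA (t : ℂ) (x : ι → ℂ) {y : κ → ℂ} (S : Finset ι) (T : Finset κ)
    (I : Finset ι) {J : Finset κ} {p : ℂ} (h : ∀ c ∈ J, y c ≠ p) :
    ContinuousAt (recTermA t x y S T I J) p := by
  by_cases hc : I.card = J.card
  · have : recTermA t x y S T I J = fun z =>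
        recCoeff t x y S T I J * kernelSet t x y I J * ∏ c ∈ J, (y c - t * z) / (y c - z) := by
      funext z; rw [recTermA, if_pos hc]
    rw [this]
    exact tendsto_const_nhds.mul (tendsto_finsetProd _ fun c hc' =>
      (tendsto_const_nhds.sub (tendsto_id.const_mul t)).div (tendsto_const_nhds.sub tendsto_id)
        (sub_ne_zero.2 (h c hc')))
  · have : recTermA t x y S T I J = fun _ => 0 := by
      funext z; rw [recTermA, if_neg hc]
    rw [this]
    exact continuousAt_const

theorem continuousAt_recTermB (t : ℂ) {x : ι → ℂ} {y : κ → ℂ} (S : Finset ι) {T : Finset κ}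
    {I : Finset ι} {J : Finset κ} {p : ℂ} (hI : ∀ a ∈ I, 1 - x a * p ≠ 0)
    (h : ∀ c ∈ T \ J, p ≠ y c) : ContinuousAt (recTermB t x y S T I J) p := by
  by_cases hc : I.card = J.card + 1
  · have : recTermB t x y S T I J = fun z => recCoeff t x y S T I J *
        ((z * kernelCons t x y I J z) * ∏ c ∈ T \ J, (z - t * y c) / (z - y c)) := by
      funext z; rw [recTermB, if_pos hc]
    rw [this]
    exact tendsto_const_nhds.mul ((tendsto_id.mul (continuousAt_kernelCons t y J hI)).mul
      (tendsto_prod_sub_div t h))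
  · have : recTermB t x y S T I J = fun _ => 0 := by
      funext z; rw [recTermB, if_neg hc]
    rw [this]
    exact continuousAt_const

theorem tendsto_recDefect_left {t : ℂ} {x : ι → ℂ} {y : κ → ℂ} {S : Finset ι} {T : Finset κ} {a : ι}
    (ha : a ∉ S) (h : GenericOn t x y (insert a S) T) (h0 : x a ≠ 0)
    (ih : recSum t x y S T = kernelSet t x y S T) :
    Tendsto (fun z => (z - (x a)⁻¹) * recDefect t x y (insert a S) T z) (𝓝[≠] (x a)⁻¹) (𝓝 0) := by
  set p := (x a)⁻¹ with hp
  have hne : ∀ b ∈ S, 1 - x b * p ≠ 0 := fun b hb h' => by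
    have hab : x b = x a := by
      rw [hp] at h'
      field_simp at h'
      linear_combination -h'
    exact ha (h.left (by simp [hb]) (by simp) hab ▸ hb)
  have hpy : ∀ c ∈ T, p ≠ y c := fun c hc h' => (h.regular a (by simp) c hc).1 (by
    rw [← h', hp, mul_inv_cancel₀ h0, sub_self])
  let K := -((1 - t) / x a) * ((∏ c ∈ T, (1 - t * (x a * y c)) / (1 - x a * y c)) *
        hlFactor t x a S)
  have hterm : ∀ I ∈ S.powerset, ∀ J ∈ T.powerset,
      Tendsto (fun z => (z - p) * recTermB t x y (insert a S) T (insert a I) J z) (𝓝[≠] p)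
        (𝓝 (K * if I.card = J.card then recCoeff t x y S T I J * kernelSet t x y I J else 0)) := by
    intro I hI J hJ
    rw [Finset.mem_powerset] at hI hJ
    have haI : a ∉ I := fun h => ha (hI h)
    by_cases hc : I.card = J.card
    · have hc' : (insert a I).card = J.card + 1 := by rw [Finset.card_insert_of_notMem haI, hc]
      have h1 := tendsto_kernelCons_pole t y J haI
        (h.left.mono (Finset.coe_subset.2 (Finset.insert_subset_insert a hI))) h0
      have h2 := (tendsto_prod_sub_div t (K := T \ J) fun c hc =>
        hpy c (Finset.mem_sdiff.1 hc).1).mono_left (nhdsWithin_le_nhds (s := {p}ᶜ))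
      have h3 : Tendsto (fun z : ℂ => z) (𝓝[≠] p) (𝓝 p) := tendsto_id.mono_left nhdsWithin_le_nhds
      have h4 := (((h3.mul h1).mul h2).const_mul
        (recCoeff t x y (insert a S) T (insert a I) J))
      rw [if_pos hc]
      refine Tendsto.congr (fun z => ?_) (h4.trans_eq ?_)
      · rw [recTermB, if_pos hc']
        ring
      · congr 1
        have h5 : ∏ c ∈ T \ J, (p - t * y c) / (p - y c) =
            ∏ c ∈ T \ J, (1 - t * (x a * y c)) / (1 - x a * y c) := by
          refine Finset.prod_congr rfl fun c _ => ?_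
          rw [hp, show (x a)⁻¹ - t * y c = (x a)⁻¹ * (1 - t * (x a * y c)) by field_simp,
            show (x a)⁻¹ - y c = (x a)⁻¹ * (1 - x a * y c) by field_simp,
            mul_div_mul_left _ _ (inv_ne_zero h0)]
        have h6 : hlFactor t x a S = hlFactor t x a I * hlFactor t x a (S \ I) := by
          rw [← hlFactor_union t x a Finset.disjoint_sdiff, Finset.union_sdiff_of_subset hI]
        have h7 : insert a S \ insert a I = S \ I := by
          rw [Finset.insert_sdiff_insert, Finset.sdiff_insert_of_notMem ha]
        have h8 : (insert a S).card - (insert a I).card = S.card - I.card := by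
          rw [Finset.card_insert_of_notMem ha, Finset.card_insert_of_notMem haI]
          omega
        simp only [recCoeff, K]
        rw [h5, h6, h7, h8, hlWeight_insert_left t x _ haI, Finset.prod_insert haI,
          ← Finset.prod_sdiff hJ]
        have hap : x a * p = 1 := mul_inv_cancel₀ h0
        generalize (1 - t) / x a = k
        linear_combination -(qfac t (S.card - I.card) * (∏ b ∈ I, x b) * (∏ c ∈ J, y c) *
          (hlFactor t x a (S \ I) * hlWeight t x I (S \ I)) * hlWeight t y J (T \ J) * k *
          (∏ c ∈ J, (1 - t * (x a * y c)) / (1 - x a * y c)) * hlFactor t x a I *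
          kernelSet t x y I J * ∏ c ∈ T \ J, (1 - t * (x a * y c)) / (1 - x a * y c)) * hap
    · have hc' : (insert a I).card ≠ J.card + 1 := by
        rw [Finset.card_insert_of_notMem haI]
        omega
      simp only [recTermB, if_neg hc, if_neg hc', mul_zero]
      exact tendsto_const_nhds
  have hA : ∀ I, ∀ J ∈ T.powerset,
      Tendsto (fun z => (z - p) * recTermA t x y (insert a S) T I J z) (𝓝[≠] p) (𝓝 0) :=
    fun I J hJ => tendsto_sub_mul_of_continuousAt (continuousAt_recTermA t x _ T I
      fun c hc => (hpy c (Finset.mem_powerset.1 hJ hc)).symm)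
  have hB : ∀ I ∈ S.powerset, ∀ J ∈ T.powerset,
      Tendsto (fun z => (z - p) * recTermB t x y (insert a S) T I J z) (𝓝[≠] p) (𝓝 0) :=
    fun I hI J hJ => tendsto_sub_mul_of_continuousAt (continuousAt_recTermB t _
      (fun b hb => hne b (Finset.mem_powerset.1 hI hb)) fun c hc => hpy c (Finset.mem_sdiff.1 hc).1)
  have hsum := (tendsto_finsetSum S.powerset fun I hI => tendsto_finsetSum T.powerset fun J hJ =>
    ((hA I J hJ).add (hB I hI J hJ)).add ((hA (insert a I) J hJ).add (hterm I hI J hJ))).sub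
    (tendsto_kernelCons_pole t y T ha h.left h0)
  refine Tendsto.congr (fun z => ?_) (hsum.trans_eq ?_)
  · rw [recDefect, mul_sub, Finset.sum_powerset_insert ha, ← Finset.sum_add_distrib, Finset.mul_sum]
    congr 1
    refine Finset.sum_congr rfl fun I _ => ?_
    rw [← Finset.sum_add_distrib, Finset.mul_sum]
    refine Finset.sum_congr rfl fun J _ => ?_
    ring
  · congr 1
    simp only [zero_add, ← Finset.mul_sum]
    rw [show (∑ I ∈ S.powerset, ∑ J ∈ T.powerset, if I.card = J.card then
      recCoeff t x y S T I J * kernelSet t x y I J else 0) = recSum t x y S T from rfl, ih]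
    simp only [K]
    ring

theorem tendsto_recDefect_right {t : ℂ} {x : ι → ℂ} {y : κ → ℂ} {S : Finset ι} {T : Finset κ}
    {c : κ} (hcT : c ∉ T) (h : GenericOn t x y S (insert c T)) :
    Tendsto (fun z => (z - y c) * recDefect t x y S (insert c T) z) (𝓝[≠] (y c)) (𝓝 0) := by
  have hreg : ∀ a ∈ S, 1 - x a * y c ≠ 0 := fun a ha => (h.regular a ha c (by simp)).1
  have hyc : ∀ d ∈ T, y c ≠ y d := fun d hd h' =>
    hcT (h.right (by simp) (by simp [hd]) h' ▸ hd)
  have hcancel : ∀ I ∈ S.powerset, ∀ J ∈ T.powerset, Tendsto (fun z => (z - y c) *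
      (recTermB t x y S (insert c T) I J z + recTermA t x y S (insert c T) I (insert c J) z))
      (𝓝[≠] (y c)) (𝓝 0) := by
    intro I hI J hJ
    rw [Finset.mem_powerset] at hI hJ
    have hcJ : c ∉ J := fun h => hcT (hJ h)
    have hcd : (insert c J).card = J.card + 1 := Finset.card_insert_of_notMem hcJ
    by_cases hc : I.card = J.card + 1
    · have hker : kernelCons t x y I J (y c) = kernelSet t x y I (insert c J) :=
        (kernelSet_insert (h.mono hI (Finset.insert_subset_insert _ hJ)) hcJ hc).symm
      have hz : Tendsto (fun z : ℂ => z) (𝓝 (y c)) (𝓝 (y c)) := tendsto_id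
      have h1 : Tendsto (fun z => recCoeff t x y S (insert c T) I J *
          ((z * kernelCons t x y I J z) * ((z - t * y c) *
            ∏ d ∈ T \ J, (z - t * y d) / (z - y d)))) (𝓝 (y c))
          (𝓝 (recCoeff t x y S (insert c T) I J *
          ((y c * kernelCons t x y I J (y c)) * ((y c - t * y c) *
            ∏ d ∈ T \ J, (y c - t * y d) / (y c - y d))))) :=
        tendsto_const_nhds.mul ((hz.mul (continuousAt_kernelCons t y J fun a ha =>
          hreg a (hI ha))).mul ((hz.sub tendsto_const_nhds).mul
          (tendsto_prod_sub_div t fun d hd => hyc d (Finset.mem_sdiff.1 hd).1)))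
      have h2 : Tendsto (fun z => recCoeff t x y S (insert c T) I (insert c J) *
          kernelSet t x y I (insert c J) * ((t * z - y c) *
            ∏ d ∈ J, (y d - t * z) / (y d - z))) (𝓝 (y c))
          (𝓝 (recCoeff t x y S (insert c T) I (insert c J) * kernelSet t x y I (insert c J) *
            ((t * y c - y c) * ∏ d ∈ J, (y d - t * y c) / (y d - y c)))) :=
        tendsto_const_nhds.mul (((hz.const_mul t).sub tendsto_const_nhds).mul
          (tendsto_finsetProd _ fun d hd => (tendsto_const_nhds.sub (hz.const_mul t)).div
            (tendsto_const_nhds.sub hz) (sub_ne_zero.2 (hyc d (hJ hd)).symm)))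
      refine Tendsto.congr' ?_ (((h1.add h2).mono_left nhdsWithin_le_nhds).trans_eq ?_)
      · filter_upwards [self_mem_nhdsWithin] with z hz
        have hz1 := sub_ne_zero.2 (show z ≠ y c from hz)
        rw [recTermA, recTermB, if_pos hc, if_pos (hc.trans hcd.symm), Finset.prod_insert hcJ,
          Finset.insert_sdiff_of_notMem _ hcJ,
          Finset.prod_insert fun h => hcT (Finset.mem_sdiff.1 h).1,
          show (y c - t * z) / (y c - z) = (t * z - y c) / (z - y c) by
            rw [← neg_div_neg_eq]; ring]
        field_simp
      · congr 1
        rw [hker, recCoeff, recCoeff, Finset.insert_sdiff_insert, Finset.sdiff_insert_of_notMem hcT,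
          Finset.insert_sdiff_of_notMem _ hcJ,
          hlWeight_insert_right t y J fun h => hcT (Finset.mem_sdiff.1 h).1,
          hlWeight_insert_left t y _ hcJ, Finset.prod_insert hcJ, hlFactor]
        ring
    · have : I.card ≠ (insert c J).card := by rwa [hcd]
      simp only [recTermA, recTermB, if_neg hc, if_neg this, add_zero, mul_zero]
      exact tendsto_const_nhds
  have hA : ∀ I, ∀ J ∈ T.powerset, Tendsto (fun z => (z - y c) *
      recTermA t x y S (insert c T) I J z) (𝓝[≠] (y c)) (𝓝 0) :=
    fun I J hJ => tendsto_sub_mul_of_continuousAt (continuousAt_recTermA t x _ _ I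
      fun d hd => (hyc d (Finset.mem_powerset.1 hJ hd)).symm)
  have hB : ∀ I ∈ S.powerset, ∀ J ∈ T.powerset, Tendsto (fun z => (z - y c) *
      recTermB t x y S (insert c T) I (insert c J) z) (𝓝[≠] (y c)) (𝓝 0) := by
    intro I hI J _
    refine tendsto_sub_mul_of_continuousAt (continuousAt_recTermB t _
      (fun a ha => hreg a (Finset.mem_powerset.1 hI ha)) fun d hd => hyc d ?_)
    simp only [Finset.mem_sdiff, Finset.mem_insert, not_or] at hd
    tauto
  have hsum := (tendsto_finsetSum S.powerset fun I hI => tendsto_finsetSum T.powerset fun J hJ =>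
    ((hA I J hJ).add (hB I hI J hJ)).add (hcancel I hI J hJ)).sub
    (tendsto_sub_mul_of_continuousAt (continuousAt_kernelCons t y (insert c T) hreg))
  simp only [add_zero, Finset.sum_const_zero, sub_zero] at hsum
  refine hsum.congr fun z => ?_
  rw [recDefect, mul_sub, Finset.mul_sum]
  congr 1
  refine Finset.sum_congr rfl fun I _ => ?_
  rw [Finset.sum_powerset_insert hcT, ← Finset.sum_add_distrib, Finset.mul_sum]
  refine Finset.sum_congr rfl fun J _ => ?_
  ring

theorem tendsto_recSum {α : Type*} {F : Filter α} {X : α → ι → ℂ} {x : ι → ℂ} {Y : α → κ → ℂ}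
    {y : κ → ℂ} (t : ℂ) {S : Finset ι} {T : Finset κ} {W : Finset κ → ℂ}
    (hX : ∀ a ∈ S, Tendsto (fun s => X s a) F (𝓝 (x a)))
    (hY : ∀ c ∈ T, Tendsto (fun s => Y s c) F (𝓝 (y c))) (hx : Set.InjOn x S)
    (hr : ∀ a ∈ S, ∀ c ∈ T, 1 - x a * y c ≠ 0)
    (hW : ∀ J ⊆ T, Tendsto (fun s => hlWeight t (Y s) J (T \ J)) F (𝓝 (W J))) :
    Tendsto (fun s => recSum t (X s) (Y s) S T) F (𝓝 (∑ I ∈ S.powerset, ∑ J ∈ T.powerset,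
      if I.card = J.card then qfac t (S.card - I.card) * (∏ a ∈ I, x a) * (∏ c ∈ J, y c) *
        hlWeight t x I (S \ I) * W J * kernelSet t x y I J else 0)) := by
  refine tendsto_finsetSum _ fun I hI => tendsto_finsetSum _ fun J hJ => ?_
  rw [Finset.mem_powerset] at hI hJ
  split_ifs
  · refine Tendsto.mul ((((tendsto_const_nhds.mul ?_).mul ?_).mul
      (tendsto_hlWeight t hI hX hx)).mul (hW J hJ)) ?_
    · exact tendsto_finsetProd _ fun a ha => hX a (hI ha)
    · exact tendsto_finsetProd _ fun c hc => hY c (hJ hc)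
    · exact tendsto_kernelSum t (fun a ha => hX a (hI ha))
        (fun c hc => hY c (hJ (Finset.mem_toList.1 hc))) (hx.mono (Finset.coe_subset.2 hI))
        fun a ha c hc => hr a (hI ha) c (hJ (Finset.mem_toList.1 hc))
  · exact tendsto_const_nhds

theorem recDefect_const {t : ℂ} {x : ι → ℂ} {S : Finset ι} {T : Finset κ} {n : ℕ}
    (hS : S.card = n + 1) (hT : T.card = n) (h0 : ∀ a ∈ S, x a ≠ 0)
    (ih : ∀ (S : Finset ι) (T : Finset κ), S.card = n → T.card = n → (∀ a ∈ S, x a ≠ 0) →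
      ∀ y : κ → ℂ, GenericOn t x y S T → recSum t x y S T = kernelSet t x y S T)
    {y : κ → ℂ} (h : GenericOn t x y S T) {z w : ℂ}
    (hz : ∀ a ∈ S, 1 - x a * z ≠ 0) (hz' : ∀ c ∈ T, y c ≠ z)
    (hw : ∀ a ∈ S, 1 - x a * w ≠ 0) (hw' : ∀ c ∈ T, y c ≠ w) :
    recDefect t x y S T z = recDefect t x y S T w := by
  have hP : ∀ v : ℂ, (∀ a ∈ S, 1 - x a * v ≠ 0) → (∀ c ∈ T, y c ≠ v) →
      v ∉ S.image (fun a => (x a)⁻¹) ∪ T.image y := by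
    intro v hv hv' hm
    rcases Finset.mem_union.1 hm with hm | hm
    · obtain ⟨a, ha, rfl⟩ := Finset.mem_image.1 hm
      exact hv a ha (by rw [mul_inv_cancel₀ (h0 a ha), sub_self])
    · obtain ⟨c, hc, hcv⟩ := Finset.mem_image.1 hm
      exact hv' c hc hcv
  refine (hasSimplePoles_recDefect t h h0).eq_of_residues (fun p hp => ?_) (hP z hz hz')
    (hP w hw hw')
  rcases Finset.mem_union.1 hp with hm | hm
  · obtain ⟨a, ha, rfl⟩ := Finset.mem_image.1 hm
    have hS' := Finset.insert_erase ha
    have := tendsto_recDefect_left (S := S.erase a) (Finset.notMem_erase a S)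
      (hS'.symm ▸ h) (h0 a ha) (ih _ _ (by rw [Finset.card_erase_of_mem ha, hS]; rfl) hT
        (fun b hb => h0 b (Finset.mem_of_mem_erase hb)) y
        (h.mono (Finset.erase_subset _ _) subset_rfl))
    rwa [hS'] at this
  · obtain ⟨c, hc, rfl⟩ := Finset.mem_image.1 hm
    have hT' := Finset.insert_erase hc
    have := tendsto_recDefect_right (T := T.erase c) (Finset.notMem_erase c T) (hT'.symm ▸ h)
    rwa [hT'] at this

theorem exists_injOn_ne_zero (T : Finset κ) : ∃ u : κ → ℂ, Set.InjOn u T ∧ ∀ c ∈ T, u c ≠ 0 := by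
  refine ⟨fun c => if h : c ∈ T then ((T.equivFin ⟨c, h⟩ : ℕ) : ℂ) + 1 else 0, ?_, ?_⟩
  · intro c hc d hd hcd
    rw [Finset.mem_coe] at hc hd
    simp only [hc, hd, dif_pos] at hcd
    have := Fin.val_injective (Nat.cast_injective (add_right_cancel hcd))
    simpa using T.equivFin.injective this
  · intro c hc
    simp only [hc, dif_pos]
    exact Nat.cast_add_one_ne_zero _

theorem recSum_eq_of_ne_zero {t : ℂ} {x : ι → ℂ} (n : ℕ) (S : Finset ι) (T : Finset κ)
    (hS : S.card = n) (hT : T.card = n) (h0 : ∀ a ∈ S, x a ≠ 0) (y : κ → ℂ)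
    (h : GenericOn t x y S T) : recSum t x y S T = kernelSet t x y S T := by
  induction n generalizing S T y with
  | zero =>
    rw [Finset.card_eq_zero] at hS hT
    subst hS hT
    simp [recSum, recCoeff, hlWeight, kernelSet, kernelSum, qfac]
  | succ n ih =>
    have hstep : ∀ y y' : κ → ℂ, ∀ b ∈ T, GenericOn t x y S T → GenericOn t x y' S T →
        (∀ c ∈ T, c ≠ b → y c = y' c) →
        recSum t x y S T - kernelSet t x y S T = recSum t x y' S T - kernelSet t x y' S T := by
      intro y y' b hb hy hy' hyy'
      have hT' := Finset.insert_erase hb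
      have hbT := Finset.notMem_erase b T
      have hcT : (T.erase b).card = n := by rw [Finset.card_erase_of_mem hb, hT]; rfl
      have hagree : ∀ c ∈ T.erase b, y c = y' c := fun c hc =>
        hyy' c (Finset.mem_of_mem_erase hc) (Finset.ne_of_mem_erase hc)
      have hsub : ∀ y : κ → ℂ, GenericOn t x y S T → recSum t x y S T - kernelSet t x y S T =
          recDefect t x y S (T.erase b) (y b) := by
        intro y hy
        have := recSum_sub_kernelSet (T := T.erase b) (hT'.symm ▸ hy) hbT (by rw [hS, hcT])
        rwa [hT'] at this
      rw [hsub y hy, hsub y' hy', ← recDefect_congr t x S hagree]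
      refine recDefect_const hS hcT h0 ih (hy.mono subset_rfl (Finset.erase_subset _ _))
        (fun a ha => (hy.regular a ha b hb).1) (fun c hc hcb => ?_)
        (fun a ha => (hy'.regular a ha b hb).1) fun c hc hcb => ?_
      · exact Finset.ne_of_mem_erase hc (hy.right (Finset.mem_of_mem_erase hc) hb hcb)
      · rw [hagree c hc] at hcb
        exact Finset.ne_of_mem_erase hc (hy'.right (Finset.mem_of_mem_erase hc) hb hcb)
    obtain ⟨u, hu, hu0⟩ := exists_injOn_ne_zero T
    have hsu : ∀ c, Tendsto (fun s : ℂ => s * u c) (𝓝[≠] 0) (𝓝 0) := fun c => by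
      have : Tendsto (fun s : ℂ => s * u c) (𝓝 0) (𝓝 (0 * u c)) := tendsto_id.mul_const _
      rw [zero_mul] at this
      exact this.mono_left nhdsWithin_le_nhds
    have hgood : ∀ᶠ s in 𝓝[≠] (0 : ℂ), (∀ c ∈ T, ∀ d ∈ T, s * u c ≠ y d) ∧
        ∀ a ∈ S, ∀ c ∈ T, Regular t (x a) (s * u c) := by
      refine ((Finset.eventually_all T).2 fun c hc => (Finset.eventually_all T).2 fun d _ => ?_).and
        ((Finset.eventually_all S).2 fun a _ => (Finset.eventually_all T).2 fun c _ => ?_)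
      · rcases eq_or_ne (y d) 0 with hd | hd
        · filter_upwards [self_mem_nhdsWithin] with s hs
          rw [hd]
          exact mul_ne_zero hs (hu0 c hc)
        · exact (hsu c).eventually_ne hd.symm
      · have hc := (hsu c).const_mul (x a)
        refine (Tendsto.eventually_ne (tendsto_const_nhds.sub hc) ?_).and
          (Tendsto.eventually_ne (tendsto_const_nhds.sub (hc.const_mul t)) ?_) <;> simp
    let Y : ℂ → κ → ℂ := fun s => T.piecewise (fun c => s * u c) y
    have hconst : ∀ᶠ s in 𝓝[≠] (0 : ℂ), recSum t x (Y s) S T - kernelSet t x (Y s) S T =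
        recSum t x y S T - kernelSet t x y S T := by
      filter_upwards [hgood, self_mem_nhdsWithin] with s hs hs0
      have hgen : ∀ K ⊆ T, GenericOn t x (K.piecewise (fun c => s * u c) y) S T := by
        intro K hK
        refine ⟨h.left, fun c hc d hd hcd => ?_, fun a ha c hc => ?_⟩
        · by_cases hcK : c ∈ K <;> by_cases hdK : d ∈ K <;>
            simp only [Finset.piecewise, hcK, hdK, if_true, if_false] at hcd
          · exact hu hc hd (mul_left_cancel₀ hs0 hcd)
          · exact absurd hcd (hs.1 c hc d hd)
          · exact absurd hcd.symm (hs.1 d hd c hc)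
          · exact h.right hc hd hcd
        · by_cases hcK : c ∈ K <;> simp only [Finset.piecewise, hcK, if_true, if_false]
          · exact hs.2 a ha c hc
          · exact h.regular a ha c hc
      have hind : ∀ K ⊆ T, recSum t x (K.piecewise (fun c => s * u c) y) S T -
          kernelSet t x (K.piecewise (fun c => s * u c) y) S T =
          recSum t x y S T - kernelSet t x y S T := by
        intro K hK
        induction K using Finset.induction_on with
        | empty => rw [Finset.piecewise_empty]
        | insert b K hb ihK =>
          have hK' := (Finset.subset_insert b K).trans hK
          rw [← ihK hK']
          refine (hstep _ _ b (hK (by simp)) (hgen K hK') (hgen _ hK) fun c _ hcb => ?_).symm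
          simp [Finset.piecewise, hcb]
      exact hind T subset_rfl
    have hY : ∀ c ∈ T, ∀ s, Y s c = s * u c := fun c hc s => Finset.piecewise_eq_of_mem _ _ _ hc
    have hY0 : ∀ c ∈ T, Tendsto (fun s => Y s c) (𝓝[≠] (0 : ℂ)) (𝓝 0) := fun c hc => by
      simpa only [hY c hc] using hsu c
    have hlim1 := tendsto_recSum (F := 𝓝[≠] (0 : ℂ)) (X := fun _ => x) (x := x) (Y := Y)
      (y := fun _ => 0) t (S := S) (T := T) (W := fun J => hlWeight t u J (T \ J))
      (fun _ _ => tendsto_const_nhds) hY0 h.left (fun a _ c _ => by simp) fun J hJ => by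
        refine tendsto_const_nhds.congr' ?_
        filter_upwards [self_mem_nhdsWithin] with s hs
        refine Finset.prod_congr rfl fun a ha => Finset.prod_congr rfl fun b hb => ?_
        rw [hY a (hJ ha), hY b (Finset.mem_sdiff.1 hb).1,
          show s * u a - t * (s * u b) = s * (u a - t * u b) by ring, ← mul_sub,
          mul_div_mul_left _ _ hs]
    have hlim2 : Tendsto (fun s => kernelSet t x (Y s) S T) (𝓝[≠] 0)
        (𝓝 (kernelSet t x (fun _ => 0) S T)) :=
      tendsto_kernelSum t (fun _ _ => tendsto_const_nhds)
        (fun c hc => hY0 c (Finset.mem_toList.1 hc)) h.left fun a _ c _ => by simp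
    have hval1 : (∑ I ∈ S.powerset, ∑ J ∈ T.powerset, if I.card = J.card then
        qfac t (S.card - I.card) * (∏ a ∈ I, x a) * (∏ c ∈ J, (0 : ℂ)) *
        hlWeight t x I (S \ I) * hlWeight t u J (T \ J) * kernelSet t x (fun _ => 0) I J else 0) =
        qfac t (n + 1) := by
      rw [Finset.sum_eq_single ∅, Finset.sum_eq_single ∅]
      · simp [hS, hlWeight, kernelSet, kernelSum]
      · intro J _ hJ
        rw [if_neg]
        rw [Finset.card_empty, eq_comm, Finset.card_eq_zero]
        exact hJ
      · simp
      · intro I _ hI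
        refine Finset.sum_eq_zero fun J _ => ?_
        split_ifs with hc
        · have hJ : J.card ≠ 0 := by rw [← hc, Ne, Finset.card_eq_zero]; exact hI
          rw [Finset.prod_const, zero_pow hJ]
          ring
        · rfl
      · simp
    have hval2 : kernelSet t x (fun _ : κ => 0) S T = qfac t (n + 1) := by
      rw [kernelSet, List.map_const', Finset.length_toList, hT, kernelSum_zero t x _ hS h.left]
    have hlim := hlim1.sub hlim2
    rw [hval1, hval2, sub_self] at hlim
    exact sub_eq_zero.1 (tendsto_nhds_unique_of_eventuallyEq tendsto_const_nhds hlim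
      (hconst.mono fun s hs => hs.symm))

theorem recSum_eq {t : ℂ} {x : ι → ℂ} {y : κ → ℂ} {S : Finset ι} {T : Finset κ}
    (hST : S.card = T.card) (h : GenericOn t x y S T) :
    recSum t x y S T = kernelSet t x y S T := by
  have hX : ∀ a ∈ S, Tendsto (fun ε : ℂ => x a + ε) (𝓝[≠] 0) (𝓝 (x a)) :=
    fun a _ => tendsto_translate x a
  have h1 := tendsto_recSum (F := 𝓝[≠] (0 : ℂ)) (X := fun ε a => x a + ε) (Y := fun _ => y) (y := y)
    t (S := S) (T := T) (W := fun J => hlWeight t y J (T \ J)) hX (fun _ _ => tendsto_const_nhds)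
    h.left (fun a ha c hc => (h.regular a ha c hc).1) fun _ _ => tendsto_const_nhds
  have h2 : Tendsto (fun ε : ℂ => kernelSet t (fun a => x a + ε) y S T) (𝓝[≠] 0)
      (𝓝 (kernelSet t x y S T)) :=
    tendsto_kernelSum t hX (fun _ _ => tendsto_const_nhds) h.left
      fun a ha c hc => (h.regular a ha c (Finset.mem_toList.1 hc)).1
  refine (tendsto_nhds_unique_of_eventuallyEq h2 h1 ?_).symm ▸ rfl
  filter_upwards [eventually_translate_regular t x y S T h.regular] with ε hε
  refine (recSum_eq_of_ne_zero _ S T rfl hST.symm hε.1 y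
    ⟨fun a ha b hb hab => h.left ha hb (by simpa using hab), h.right, hε.2⟩).symm

end Recursion

section Partitions

/-- The sequence of the parts of a partition, extended by zero. -/
def partExt {n : ℕ} (l : Fin n → ℕ) (j : ℕ) : ℕ := if h : j < n then l ⟨j, h⟩ else 0

/-- The partition whose smallest part is `c`, and whose parts larger than `c` are the parts of `μ`
increased by `c + 1`. -/
def shiftPart (n : ℕ) {m : ℕ} (c : ℕ) (μ : Fin m → ℕ) (i : Fin n) : ℕ :=
  if h : (i : ℕ) < m then c + 1 + μ ⟨i, h⟩ else c

theorem antitone_shiftPart (n : ℕ) {m : ℕ} (c : ℕ) {μ : Fin m → ℕ} (hμ : Antitone μ) :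
    Antitone (shiftPart n c μ) := by
  intro i j hij
  rw [Fin.le_def] at hij
  simp only [shiftPart]
  split_ifs with hj hi hi
  · have := hμ (show (⟨i, hi⟩ : Fin m) ≤ ⟨j, hj⟩ from hij)
    omega
  · omega
  · omega
  · omega

theorem shiftPart_bijective {n : ℕ} (hn : 0 < n) : Function.Bijective
    fun p : ℕ × (Σ m : Fin n, {μ : Fin m → ℕ // Antitone μ}) =>
      (⟨shiftPart n p.1 p.2.2.1, antitone_shiftPart n p.1 p.2.2.2⟩ :
        {l : Fin n → ℕ // Antitone l}) := by
  constructor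
  · rintro ⟨c, ⟨m, hm⟩, μ, hμ⟩ ⟨d, ⟨k, hk⟩, ν, hν⟩ h
    have hval : ∀ i : Fin n, shiftPart n c μ i = shiftPart n d ν i :=
      congrFun (congrArg Subtype.val h)
    simp only [shiftPart] at hval
    have hcd : c = d := by
      have := hval ⟨n - 1, by omega⟩
      simpa [show ¬ n - 1 < m by omega, show ¬ n - 1 < k by omega] using this
    subst hcd
    have hmk : m = k := by
      rcases lt_trichotomy m k with hlt | heq | hlt
      · have := hval ⟨m, hm⟩
        simp only [lt_irrefl, dif_neg, not_false_eq_true, hlt, dif_pos] at this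
        omega
      · exact heq
      · have := hval ⟨k, hk⟩
        simp only [lt_irrefl, dif_neg, not_false_eq_true, hlt, dif_pos] at this
        omega
    subst hmk
    have hμν : μ = ν := by
      funext i
      have := hval ⟨i, i.2.trans hm⟩
      simpa using this
    subst hμν
    rfl
  · rintro ⟨l, hl⟩
    have hex : ∃ i, ∃ h : i < n, l ⟨i, h⟩ = l ⟨n - 1, by omega⟩ := ⟨n - 1, by omega, rfl⟩
    classical
    obtain ⟨hm, hlm⟩ := Nat.find_spec hex
    have hmin := fun i => Nat.find_min hex (m := i)
    generalize Nat.find hex = m at hm hlm hmin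
    have hge : ∀ i : Fin n, l ⟨n - 1, by omega⟩ ≤ l i := fun i => hl (by
      rw [Fin.le_def]; simp only; omega)
    have hgt : ∀ i : Fin m, l ⟨n - 1, by omega⟩ < l ⟨i, i.2.trans hm⟩ := fun i =>
      lt_of_le_of_ne (hge _) fun h => hmin i i.2 ⟨i.2.trans hm, h.symm⟩
    refine ⟨⟨l ⟨n - 1, by omega⟩, ⟨m, hm⟩,
      fun i => l ⟨i, i.2.trans hm⟩ - (l ⟨n - 1, by omega⟩ + 1), fun i j hij => ?_⟩, ?_⟩
    · exact Nat.sub_le_sub_right (hl (show (⟨i, i.2.trans hm⟩ : Fin n) ≤ ⟨j, j.2.trans hm⟩ from hij)) _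
    · refine Subtype.ext (funext fun i => ?_)
      simp only [shiftPart]
      split_ifs with hi
      · have := hgt ⟨i, hi⟩
        change l ⟨n - 1, by omega⟩ < l i at this
        change l ⟨n - 1, by omega⟩ + 1 + (l i - (l ⟨n - 1, by omega⟩ + 1)) = l i
        omega
      · refine le_antisymm (hge i) ?_
        rw [← hlm]
        exact hl (show (⟨m, hm⟩ : Fin n) ≤ i from not_lt.1 hi)

/-- `∏_{j=1}^{k} (1 - t^j) / (1 - t)`. -/
def qfacDiv (t : ℂ) (k : ℕ) : ℂ := ∏ j ∈ Finset.range k, ((1 - t ^ (j + 1)) / (1 - t))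

theorem one_sub_pow_ne_zero {t : ℂ} (ht : ‖t‖ < 1) (j : ℕ) : 1 - t ^ (j + 1) ≠ 0 := fun h => by
  have h1 : ‖t ^ (j + 1)‖ = 1 := by rw [← sub_eq_zero.1 h, norm_one]
  rw [norm_pow] at h1
  exact (pow_lt_one₀ (norm_nonneg t) ht j.succ_ne_zero).ne h1

theorem one_sub_ne_zero {t : ℂ} (ht : ‖t‖ < 1) : 1 - t ≠ 0 := by
  simpa using one_sub_pow_ne_zero ht 0

theorem qfacDiv_ne_zero {t : ℂ} (ht : ‖t‖ < 1) (k : ℕ) : qfacDiv t k ≠ 0 :=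
  Finset.prod_ne_zero_iff.2 fun j _ => div_ne_zero (one_sub_pow_ne_zero ht j) (one_sub_ne_zero ht)

theorem qfac_eq {t : ℂ} (ht : ‖t‖ < 1) (k : ℕ) : qfac t k = (1 - t) ^ k * qfacDiv t k := by
  have h : (1 - t) ^ k ≠ 0 := pow_ne_zero _ (one_sub_ne_zero ht)
  rw [qfac, qfacDiv, Finset.prod_div_distrib, Finset.prod_const, Finset.card_range,
    mul_div_cancel₀ _ h]

theorem vlam_ne_zero {n : ℕ} (l : Fin n → ℕ) {t : ℂ} (ht : ‖t‖ < 1) : vlam l t ≠ 0 :=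
  Finset.prod_ne_zero_iff.2 fun _ _ => qfacDiv_ne_zero ht _

theorem bfac0_eq {n : ℕ} (l : Fin n → ℕ) {t : ℂ} (ht : ‖t‖ < 1) :
    bfac0 l t = (1 - t) ^ n * vlam l t := by
  have hcard : ∑ i ∈ Finset.range (Finset.univ.sup l + 1), mult l i = n := by
    have := Finset.card_eq_sum_card_fiberwise (s := (Finset.univ : Finset (Fin n))) (f := l)
      (t := Finset.range (Finset.univ.sup l + 1)) fun i _ => by
        simpa using Nat.lt_succ_of_le (Finset.le_sup (Finset.mem_univ i))
    simpa [mult] using this.symm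
  have h : ∀ k, ∏ j ∈ Finset.range k, (1 - t ^ (j + 1)) = (1 - t) ^ k * qfacDiv t k := qfac_eq ht
  rw [bfac0, Finset.prod_congr rfl fun i _ => h (mult l i), Finset.prod_mul_distrib,
    Finset.prod_pow_eq_pow_sum, hcard]
  rfl

theorem vlam_eq_prod {n : ℕ} {l : Fin n → ℕ} {N : ℕ} (h : ∀ i, l i < N) (t : ℂ) :
    vlam l t = ∏ i ∈ Finset.range N, qfacDiv t (mult l i) := by
  have h0 : qfacDiv t 0 = 1 := by simp [qfacDiv]
  have hzero : ∀ M, (∀ i, l i < M) → ∀ j, M ≤ j → qfacDiv t (mult l j) = 1 := by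
    intro M hM j hj
    have : mult l j = 0 := by
      rw [mult, Finset.card_eq_zero, Finset.filter_eq_empty_iff]
      intro i _ hi
      have := hM i
      omega
    rw [this, h0]
  have hsup : ∀ i, l i < Finset.univ.sup l + 1 := fun i =>
    Nat.lt_succ_of_le (Finset.le_sup (Finset.mem_univ i))
  change ∏ i ∈ Finset.range (Finset.univ.sup l + 1), qfacDiv t (mult l i) = _
  rcases le_total (Finset.univ.sup l + 1) N with hle | hle
  · exact Finset.prod_subset (Finset.range_mono hle) fun j _ hj =>
      hzero _ hsup j (by simpa using hj)
  · exact (Finset.prod_subset (Finset.range_mono hle) fun j _ hj =>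
      hzero _ h j (by simpa using hj)).symm

theorem vlam_shiftPart (m k c : ℕ) (μ : Fin m → ℕ) (t : ℂ) :
    vlam (shiftPart (m + k) c μ) t = qfacDiv t k * vlam μ t := by
  have h0 : qfacDiv t 0 = 1 := by simp [qfacDiv]
  have hsup : ∀ i, μ i < Finset.univ.sup μ + 1 := fun i =>
    Nat.lt_succ_of_le (Finset.le_sup (Finset.mem_univ i))
  have hlt : ∀ i, shiftPart (m + k) c μ i < c + 1 + (Finset.univ.sup μ + 1) := by
    intro i
    simp only [shiftPart]
    split_ifs with h
    · have := hsup ⟨i, h⟩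
      omega
    · omega
  have hm1 : ∀ i < c, mult (shiftPart (m + k) c μ) i = 0 := by
    intro i hi
    rw [mult, Finset.card_eq_zero, Finset.filter_eq_empty_iff]
    intro j _
    simp only [shiftPart]
    split_ifs <;> omega
  have hm2 : mult (shiftPart (m + k) c μ) c = k := by
    have : Finset.univ.filter (fun i => shiftPart (m + k) c μ i = c) =
        Finset.univ.map (Fin.natAddEmb m) := by
      ext i
      rw [Finset.mem_filter]
      simp only [Finset.mem_univ, true_and, Finset.mem_map, shiftPart]
      refine Fin.addCases (fun i => ?_) (fun i => ?_) i
      · simp [Fin.ext_iff]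
        omega
      · simp
    rw [mult, this, Finset.card_map, Finset.card_univ, Fintype.card_fin]
  have hm3 : ∀ j, mult (shiftPart (m + k) c μ) (c + 1 + j) = mult μ j := by
    intro j
    have : Finset.univ.filter (fun i => shiftPart (m + k) c μ i = c + 1 + j) =
        (Finset.univ.filter fun i => μ i = j).map (Fin.castAddEmb k) := by
      ext i
      rw [Finset.mem_filter]
      simp only [Finset.mem_univ, true_and, Finset.mem_map, shiftPart]
      refine Fin.addCases (fun i => ?_) (fun i => ?_) i
      · simp
      · simp [Fin.ext_iff]
        omega
    rw [mult, this, Finset.card_map, mult]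
  rw [vlam_eq_prod hlt t, vlam_eq_prod hsup t, Finset.prod_range_add, Finset.prod_range_succ, hm2,
    Finset.prod_eq_one fun i hi => by rw [hm1 i (Finset.mem_range.1 hi), h0], one_mul]
  simp only [hm3]

end Partitions

theorem hasSum_sigma_fintype {α : Type*} [Fintype α] {β : α → Type*} {f : (Σ a, β a) → ℂ}
    {g : α → ℂ} (h : ∀ a, HasSum (fun b => f ⟨a, b⟩) (g a)) : HasSum f (∑ a, g a) := by
  classical
  have hind : ∀ a, HasSum ((Set.range (Sigma.mk a)).indicator f) (g a) := fun a => by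
    rw [← Function.Injective.hasSum_iff (sigma_mk_injective (i := a))
      fun p hp => Set.indicator_of_notMem hp f]
    exact (h a).congr_fun fun b => Set.indicator_of_mem (Set.mem_range_self b) f
  have hsum := hasSum_sum (s := Finset.univ) fun a _ => hind a
  refine hsum.congr_fun ?_
  rintro ⟨a, b⟩
  rw [Finset.sum_eq_single a, Set.indicator_of_mem (Set.mem_range_self b)]
  · intro a' _ ha'
    refine Set.indicator_of_notMem ?_ f
    rintro ⟨b', hb'⟩
    exact ha' (congrArg Sigma.fst hb')
  · simp

section Cauchy

variable {ι κ : Type*} [DecidableEq ι] [DecidableEq κ]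

/-- The Hall–Littlewood symmetrization of a monomial. -/
def hlMonomial (t : ℂ) (x : ι → ℂ) {n : ℕ} (l : Fin n → ℕ) (S : Finset ι) : ℂ :=
  hlSym t x n (fun j z => z ^ partExt l j) S

theorem hlMonomial_shiftPart {t : ℂ} (ht : t ≠ 1) {x : ι → ℂ} {m k : ℕ} (c : ℕ) (μ : Fin m → ℕ)
    {S : Finset ι} (hS : S.card = m + k) (hx : Set.InjOn x S) :
    hlMonomial t x (shiftPart (m + k) c μ) S = (∏ a ∈ S, x a) ^ c * (qfacDiv t k *
      ∑ I ∈ S.powersetCard m, (∏ a ∈ I, x a) * hlWeight t x I (S \ I) * hlMonomial t x μ I) := by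
  have hg : ∀ j < m + k, (fun z : ℂ => z ^ partExt (shiftPart (m + k) c μ) j) =
      fun z => z ^ c * (if j < m then z * z ^ partExt μ j else 1) := by
    intro j hj
    funext z
    simp only [partExt, shiftPart, hj, dif_pos]
    split_ifs with h
    · ring
    · simp
  rw [hlMonomial, hlSym_congr t x hg, hlSym_mul t x (fun z => z ^ c)
    (fun j z => if j < m then z * z ^ partExt μ j else 1) hS, Finset.prod_pow, hlSym_add,
    Finset.mul_sum _ _ (qfacDiv t k)]
  congr 1
  refine Finset.sum_congr rfl fun I hI => ?_
  obtain ⟨hIS, hIc⟩ := Finset.mem_powersetCard.1 hI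
  have h1 : hlSym t x m (fun j z => if j < m then z * z ^ partExt μ j else 1) I =
      (∏ a ∈ I, x a) * hlMonomial t x μ I := by
    rw [hlMonomial, ← hlSym_mul t x (fun z => z) _ hIc]
    exact hlSym_congr t x (fun j hj => by simp [hj]) I
  have h2 : hlSym t x k (fun j z => if m + j < m then z * z ^ partExt μ (m + j) else 1) (S \ I) =
      qfacDiv t k := by
    simp only [not_lt.2 (Nat.le_add_right m _), if_false]
    exact hlSym_one ht x k (by rw [Finset.card_sdiff_of_subset hIS, hS, hIc]; omega)
      (hx.mono (Finset.coe_subset.2 Finset.sdiff_subset))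
  rw [h1, h2]
  ring

/-- The summand of the refined Cauchy identity. -/
def cauchyTerm (t : ℂ) (x : ι → ℂ) (y : κ → ℂ) {n : ℕ} (l : Fin n → ℕ) (S : Finset ι)
    (T : Finset κ) : ℂ :=
  (1 - t) ^ n * (vlam l t)⁻¹ * hlMonomial t x l S * hlMonomial t y l T

theorem cauchyTerm_shiftPart {t : ℂ} (ht : ‖t‖ < 1) {x : ι → ℂ} {y : κ → ℂ} {n m : ℕ} (hm : m ≤ n)
    (c : ℕ) (μ : Fin m → ℕ) {S : Finset ι} {T : Finset κ} (hS : S.card = n) (hT : T.card = n)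
    (hx : Set.InjOn x S) (hy : Set.InjOn y T) :
    cauchyTerm t x y (shiftPart n c μ) S T = ((∏ a ∈ S, x a) * ∏ c ∈ T, y c) ^ c *
      ∑ I ∈ S.powersetCard m, ∑ J ∈ T.powersetCard m,
        recCoeff t x y S T I J * cauchyTerm t x y μ I J := by
  obtain ⟨k, rfl⟩ := Nat.exists_eq_add_of_le hm
  have ht1 : t ≠ 1 := (sub_ne_zero.1 (one_sub_ne_zero ht)).symm
  have hv := vlam_ne_zero μ ht
  have hq := qfacDiv_ne_zero ht k
  have hsum : ∑ I ∈ S.powersetCard m, ∑ J ∈ T.powersetCard m,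
        recCoeff t x y S T I J * cauchyTerm t x y μ I J =
      qfac t k * ((1 - t) ^ m * (vlam μ t)⁻¹) *
        ((∑ I ∈ S.powersetCard m, (∏ a ∈ I, x a) * hlWeight t x I (S \ I) * hlMonomial t x μ I) *
        ∑ J ∈ T.powersetCard m, (∏ a ∈ J, y a) * hlWeight t y J (T \ J) * hlMonomial t y μ J) := by
    rw [Finset.sum_mul_sum, Finset.mul_sum]
    refine Finset.sum_congr rfl fun I hI => ?_
    rw [Finset.mul_sum]
    refine Finset.sum_congr rfl fun J _ => ?_
    rw [recCoeff, cauchyTerm, hS, (Finset.mem_powersetCard.1 hI).2, Nat.add_sub_cancel_left]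
    ring
  rw [hsum, cauchyTerm, vlam_shiftPart, hlMonomial_shiftPart ht1 c μ hS hx,
    hlMonomial_shiftPart ht1 c μ hT hy, qfac_eq ht]
  field_simp
  ring

theorem recSum_eq_sum_range (t : ℂ) (x : ι → ℂ) (y : κ → ℂ) {n : ℕ} {S : Finset ι}
    {T : Finset κ} (hS : S.card = n) (hT : T.card = n) :
    recSum t x y S T = (∑ m : Fin n, ∑ I ∈ S.powersetCard m, ∑ J ∈ T.powersetCard m,
        recCoeff t x y S T I J * kernelSet t x y I J) +
      ((∏ a ∈ S, x a) * ∏ c ∈ T, y c) * kernelSet t x y S T := by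
  have hsub : ∀ I, ∑ J ∈ T.powerset, (if I.card = J.card then
      recCoeff t x y S T I J * kernelSet t x y I J else 0) =
      ∑ J ∈ T.powersetCard I.card, recCoeff t x y S T I J * kernelSet t x y I J := fun I => by
    rw [Finset.powersetCard_eq_filter, Finset.sum_filter]
    exact Finset.sum_congr rfl fun J _ => by simp only [eq_comm]
  rw [recSum, Finset.sum_congr rfl fun I _ => hsub I, Finset.sum_powerset, hS,
    Finset.sum_range_succ, ← Fin.sum_univ_eq_sum_range (fun m => ∑ I ∈ S.powersetCard m,
      ∑ J ∈ T.powersetCard I.card, recCoeff t x y S T I J * kernelSet t x y I J)]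
  congr 1
  · refine Finset.sum_congr rfl fun m _ => Finset.sum_congr rfl fun I hI => ?_
    rw [(Finset.mem_powersetCard.1 hI).2]
  · have h1 : S.powersetCard n = {S} := by rw [← hS, Finset.powersetCard_self]
    have h2 : T.powersetCard S.card = {T} := by rw [hS, ← hT, Finset.powersetCard_self]
    rw [h1, Finset.sum_singleton, h2, Finset.sum_singleton]
    simp [recCoeff, qfac, hlWeight, hlFactor]

theorem hasSum_cauchyTerm {t : ℂ} (ht : ‖t‖ < 1) {x : ι → ℂ} {y : κ → ℂ} {n : ℕ} {S : Finset ι}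
    {T : Finset κ} (hS : S.card = n) (hT : T.card = n) (h : GenericOn t x y S T)
    (hx : ∀ a ∈ S, ‖x a‖ < 1) (hy : ∀ c ∈ T, ‖y c‖ < 1) :
    HasSum (fun l : {l : Fin n → ℕ // Antitone l} => cauchyTerm t x y l.1 S T)
      (kernelSet t x y S T) := by
  induction n using Nat.strong_induction_on generalizing S T with
  | _ n ih =>
  rcases Nat.eq_zero_or_pos n with rfl | hn
  · obtain rfl := Finset.card_eq_zero.1 hS
    obtain rfl := Finset.card_eq_zero.1 hT
    have : Unique {l : Fin 0 → ℕ // Antitone l} :=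
      ⟨⟨⟨Fin.elim0, fun i => i.elim0⟩⟩, fun l => Subtype.ext (funext fun i => i.elim0)⟩
    have hterm : ∀ l : Fin 0 → ℕ, cauchyTerm t x y l ∅ ∅ = kernelSet t x y ∅ ∅ := fun l => by
      simp [cauchyTerm, hlMonomial, hlSym, kernelSet, kernelSum, vlam, mult]
    have hunique := hasSum_unique fun l : {l : Fin 0 → ℕ // Antitone l} => cauchyTerm t x y l.1 ∅ ∅
    rwa [hterm] at hunique
  · set q : ℂ := (∏ a ∈ S, x a) * ∏ c ∈ T, y c with hq_def
    have hq : ‖q‖ < 1 := by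
      obtain ⟨a, ha⟩ := Finset.card_pos.1 (hS ▸ hn)
      rw [hq_def, norm_mul, norm_prod, ← Finset.mul_prod_erase S _ ha, norm_prod]
      have h1 : ∏ b ∈ S.erase a, ‖x b‖ ≤ 1 := Finset.prod_le_one (fun _ _ => norm_nonneg _)
        fun b hb => (hx b (Finset.mem_of_mem_erase hb)).le
      have h2 : ∏ c ∈ T, ‖y c‖ ≤ 1 := Finset.prod_le_one (fun _ _ => norm_nonneg _)
        fun c hc => (hy c hc).le
      calc ‖x a‖ * (∏ b ∈ S.erase a, ‖x b‖) * ∏ c ∈ T, ‖y c‖ ≤ ‖x a‖ * 1 * 1 := by gcongr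
        _ < 1 := by simpa using hx a ha
    have hlayer : ∀ m < n, HasSum (fun μ : {μ : Fin m → ℕ // Antitone μ} =>
        ∑ I ∈ S.powersetCard m, ∑ J ∈ T.powersetCard m,
          recCoeff t x y S T I J * cauchyTerm t x y μ.1 I J)
        (∑ I ∈ S.powersetCard m, ∑ J ∈ T.powersetCard m,
          recCoeff t x y S T I J * kernelSet t x y I J) := fun m hm => by
      refine hasSum_sum fun I hI => hasSum_sum fun J hJ => HasSum.mul_left _ ?_
      obtain ⟨hI, hIc⟩ := Finset.mem_powersetCard.1 hI
      obtain ⟨hJ, hJc⟩ := Finset.mem_powersetCard.1 hJ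
      exact ih m hm hIc hJc (h.mono hI hJ) (fun a ha => hx a (hI ha)) fun c hc => hy c (hJ hc)
    let F : (Σ m : Fin n, {μ : Fin m → ℕ // Antitone μ}) → ℂ := fun p =>
      ∑ I ∈ S.powersetCard p.1, ∑ J ∈ T.powersetCard p.1,
        recCoeff t x y S T I J * cauchyTerm t x y p.2.1 I J
    set G : ℂ := ∑ m : Fin n, ∑ I ∈ S.powersetCard m, ∑ J ∈ T.powersetCard m,
      recCoeff t x y S T I J * kernelSet t x y I J with hG
    have hF : HasSum F G := hasSum_sigma_fintype fun m => hlayer m m.2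
    have hgeo := hasSum_geometric_of_norm_lt_one hq
    have hmul := hgeo.mul hF
      (summable_mul_of_summable_norm hgeo.summable.norm hF.summable.norm)
    have hval : (1 - q)⁻¹ * G = kernelSet t x y S T := by
      have hrec := recSum_eq (hS.trans hT.symm) h
      rw [recSum_eq_sum_range t x y hS hT, ← hG, ← hq_def] at hrec
      rw [inv_mul_eq_iff_eq_mul₀ (one_sub_ne_zero hq)]
      linear_combination hrec
    rw [hval] at hmul
    refine (Equiv.ofBijective _ (shiftPart_bijective hn)).hasSum_iff.1 (hmul.congr_fun fun p => ?_)
    exact cauchyTerm_shiftPart ht p.2.1.2.le p.1 p.2.2.1 hS hT h.left h.right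

end Cauchy

theorem hallLittlewood_eq {n : ℕ} (l : Fin n → ℕ) (x : Fin n → ℂ) (t : ℂ) :
    hallLittlewood l x t = (vlam l t)⁻¹ * hlMonomial t x l Finset.univ := by
  rw [hallLittlewood, hlMonomial, ← sum_perm_eq_hlSym]
  simp [partExt]

theorem regular_of_norm_lt_one {t x y : ℂ} (ht : ‖t‖ < 1) (hx : ‖x‖ < 1) (hy : ‖y‖ < 1) :
    Regular t x y := by
  have hxy : ‖x * y‖ < 1 := by
    rw [norm_mul]
    exact mul_lt_one_of_nonneg_of_lt_one_left (norm_nonneg _) hx hy.le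
  refine ⟨one_sub_ne_zero hxy, one_sub_ne_zero ?_⟩
  rw [norm_mul]
  exact mul_lt_one_of_nonneg_of_lt_one_left (norm_nonneg _) ht hxy.le

/-- **Kirillov–Noumi, Warnaar** (Theorem 2):
`Σ_λ ∏_{i≥0} ∏_{j=1}^{m_i(λ)} (1-t^j) P_λ(x;t) P_λ(y;t)
  = (∏_{i,j} (1-t xᵢyⱼ) / (Δ(x)ₙ Δ(y)ₙ)) · det[(1-t)/((1-xᵢyⱼ)(1-t xᵢyⱼ))]`,
the sum being over all partitions `λ` with `ℓ(λ) ≤ n` and `m₀(λ) = n - ℓ(λ)`.  It is stated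
here for complex values of the variables in a domain of convergence. -/
theorem refined_cauchy_hall_littlewood (n : ℕ) (hn : 1 ≤ n) (x y : Fin n → ℂ) (t : ℂ)
    (hx : ∀ i, ‖x i‖ < 1 / (8 * n)) (hy : ∀ j, ‖y j‖ < 1 / (8 * n)) (ht : ‖t‖ < 1)
    (hxinj : Function.Injective x) (hyinj : Function.Injective y) :
    HasSum
      (fun l : {l : Fin n → ℕ // Antitone l} =>
        bfac0 l.1 t * hallLittlewood l.1 x t * hallLittlewood l.1 y t)
      ((∏ i : Fin n, ∏ j : Fin n, (1 - t * (x i * y j))) / (vprod x * vprod y) *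
        (Matrix.of fun i j : Fin n =>
          (1 - t) / ((1 - x i * y j) * (1 - t * (x i * y j)))).det) := by
  have hone : (1 : ℝ) / (8 * n) ≤ 1 := by
    have : (1 : ℝ) ≤ n := by exact_mod_cast hn
    rw [div_le_one (by positivity)]
    linarith
  have hx1 : ∀ i, ‖x i‖ < 1 := fun i => (hx i).trans_le hone
  have hy1 : ∀ j, ‖y j‖ < 1 := fun j => (hy j).trans_le hone
  have hreg : ∀ i j, Regular t (x i) (y j) := fun i j => regular_of_norm_lt_one ht (hx1 i) (hy1 j)
  have hsum := hasSum_cauchyTerm ht (S := Finset.univ) (T := Finset.univ) (x := x) (y := y)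
    (Finset.card_fin n) (Finset.card_fin n)
    ⟨hxinj.injOn, hyinj.injOn, fun i _ j _ => hreg i j⟩ (fun i _ => hx1 i) fun j _ => hy1 j
  have hperm : (Finset.univ.toList.map y).Perm (List.ofFn y) := by
    rw [List.ofFn_eq_map]
    refine List.Perm.map y ((List.perm_ext_iff_of_nodup (Finset.nodup_toList _)
      (List.nodup_finRange n)).2 fun i => ?_)
    simp
  have hker : kernelSet t x y Finset.univ Finset.univ = kernelDet t x y := by
    rw [kernelSet, ← kernelSum_ofFn t hxinj hyinj hreg]
    refine kernelSum_perm t hperm (by simp) hxinj.injOn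
      ((Finset.nodup_toList _).map hyinj) fun i _ c hc => ?_
    obtain ⟨j, -, rfl⟩ := List.mem_map.1 hc
    exact hreg i j
  rw [hker] at hsum
  refine hsum.congr_fun fun l => ?_
  have hv := vlam_ne_zero l.1 ht
  rw [hallLittlewood_eq, hallLittlewood_eq, bfac0_eq l.1 ht, cauchyTerm]
  field_simp
end
end

section
/- Let n ≥ 1. Then Σ_λ ∏_{i=2,4,6,…,2n} (1 − t^{λ_i−i+2n+1}) · s_λ(x_1,…,x_{2n}) = (1/Δ(x)_{2n}) · Pf[ (x_i − x_j)(1−t) / ((1 − x_i x_j)(1 − t x_i x_j)) ]_{1≤i<j≤2n}, where the sum is over all partitions λ with ℓ(λ) ≤ 2n whose conjugate λ' has all parts even, i.e. λ_{2k−1} = λ_{2k} for all k ≥ 1. -/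
noncomputable section

open scoped BigOperators

/-- The Schur polynomial `s_λ(x₁,…,xₙ) = det[xᵢ^{λⱼ - j + n}]/Δ(x)ₙ` (0-indexed). -/
def schurPoly {n : ℕ} (l : Fin n → ℕ) (x : Fin n → ℂ) : ℂ :=
  (Matrix.of fun i j : Fin n => x i ^ (l j + (n - 1 - (j : ℕ)))).det / vprod x

/-- The element of `Fin (2*n)` at even position `2k`. -/
def fe (n : ℕ) (k : Fin n) : Fin (2 * n) :=
  ⟨2 * (k : ℕ), by have := k.isLt; omega⟩

/-- The element of `Fin (2*n)` at odd position `2k+1`. -/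
def fo (n : ℕ) (k : Fin n) : Fin (2 * n) :=
  ⟨2 * (k : ℕ) + 1, by have := k.isLt; omega⟩

/-- The Pfaffian of a (skew-symmetric) `2n × 2n` matrix, defined as the sum over all
perfect matchings: permutations `σ` with `σ(2k) < σ(2k+1)` and
`σ(0) < σ(2) < ⋯ < σ(2n-2)`, of `sign σ · ∏ₖ A (σ (2k)) (σ (2k+1))`. -/
def pf {R : Type*} [CommRing R] {n : ℕ} (A : Matrix (Fin (2 * n)) (Fin (2 * n)) R) : R :=
  ∑ σ ∈ Finset.univ.filter (fun σ : Equiv.Perm (Fin (2 * n)) =>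
      (∀ k : Fin n, σ (fe n k) < σ (fo n k)) ∧
        ∀ k l : Fin n, k < l → σ (fe n k) < σ (fe n l)),
    ((Equiv.Perm.sign σ : ℤ) : R) * ∏ k : Fin n, A (σ (fe n k)) (σ (fo n k))

theorem fe_injective (n : ℕ) : Function.Injective (fe n) := fun a b h => by
  simp only [fe, Fin.mk.injEq] at h
  exact Fin.ext (by omega)

theorem fo_injective (n : ℕ) : Function.Injective (fo n) := fun a b h => by
  simp only [fo, Fin.mk.injEq] at h
  exact Fin.ext (by omega)

theorem fe_ne_fo (n : ℕ) (a b : Fin n) : fe n a ≠ fo n b := fun h => by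
  simp only [fe, fo, Fin.mk.injEq] at h
  omega

/-- The splitting of `Fin (2 * n)` into its elements at even and at odd positions. -/
def evenOddEquiv (n : ℕ) : Fin n ⊕ Fin n ≃ Fin (2 * n) :=
  Equiv.ofBijective (Sum.elim (fe n) (fo n)) <| by
    rw [Fintype.bijective_iff_injective_and_card]
    refine ⟨(fe_injective n).sumElim (fo_injective n) (fe_ne_fo n), ?_⟩
    simp [two_mul]

theorem evenOddEquiv_inl (n : ℕ) (k : Fin n) : evenOddEquiv n (Sum.inl k) = fe n k := rfl

theorem evenOddEquiv_inr (n : ℕ) (k : Fin n) : evenOddEquiv n (Sum.inr k) = fo n k := rfl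

theorem forall_fin_two_mul {n : ℕ} {p : Fin (2 * n) → Prop} :
    (∀ i, p i) ↔ ∀ k, p (fe n k) ∧ p (fo n k) := by
  rw [← (evenOddEquiv n).forall_congr_right]
  simp [evenOddEquiv_inl, evenOddEquiv_inr, forall_and]

theorem prod_fin_two_mul {R : Type*} [CommMonoid R] {n : ℕ} (f : Fin (2 * n) → R) :
    ∏ i, f i = ∏ k, f (fe n k) * f (fo n k) := by
  rw [← (evenOddEquiv n).prod_comp, Fintype.prod_sum_type, ← Finset.prod_mul_distrib]
  rfl

/-- The permutation of `Fin (2 * n)` that permutes the `n` consecutive pairs by `π`. -/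
def pairPerm {n : ℕ} (π : Equiv.Perm (Fin n)) : Equiv.Perm (Fin (2 * n)) :=
  (evenOddEquiv n).permCongr (Equiv.sumCongr π π)

theorem pairPerm_fe {n : ℕ} (π : Equiv.Perm (Fin n)) (k : Fin n) :
    pairPerm π (fe n k) = fe n (π k) := by
  simp [pairPerm, ← evenOddEquiv_inl, Equiv.permCongr_apply]

theorem pairPerm_fo {n : ℕ} (π : Equiv.Perm (Fin n)) (k : Fin n) :
    pairPerm π (fo n k) = fo n (π k) := by
  simp [pairPerm, ← evenOddEquiv_inr, Equiv.permCongr_apply]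

theorem sign_pairPerm {n : ℕ} (π : Equiv.Perm (Fin n)) :
    Equiv.Perm.sign (pairPerm π) = 1 := by
  rw [pairPerm, Equiv.Perm.sign_permCongr, ← Equiv.Perm.sumCongr, Equiv.Perm.sign_sumCongr,
    Int.units_mul_self]

theorem existsUnique_strictMono_comp_perm {n : ℕ} {α : Type*} [LinearOrder α] (f : Fin n → α)
    (hf : Function.Injective f) : ∃! π : Equiv.Perm (Fin n), StrictMono (f ∘ π) := by
  refine ⟨Tuple.sort f,
    (Tuple.monotone_sort f).strictMono_of_injective (hf.comp (Equiv.injective _)), ?_⟩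
  intro π hπ
  ext1 k
  exact hf (congrFun (Tuple.unique_monotone hπ.monotone (Tuple.monotone_sort f)) k)

open Classical in
theorem sum_perm_ite_strictMono {n : ℕ} {α R : Type*} [LinearOrder α] [AddCommMonoid R]
    (f : Fin n → α) (hf : Function.Injective f) (r : R) :
    ∑ π : Equiv.Perm (Fin n), (if StrictMono (f ∘ π) then r else 0) = r := by
  obtain ⟨π, hπ, hu⟩ := existsUnique_strictMono_comp_perm f hf
  rw [Finset.sum_eq_single π, if_pos hπ]
  · intro τ _ hτ
    exact if_neg fun h => hτ (hu τ h)
  · simp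

open Classical in
theorem sum_perm_ite_strictAnti {n : ℕ} {α R : Type*} [LinearOrder α] [AddCommMonoid R]
    (f : Fin n → α) (hf : Function.Injective f) (r : R) :
    ∑ π : Equiv.Perm (Fin n), (if StrictAnti (f ∘ π) then r else 0) = r := by
  have h := sum_perm_ite_strictMono (OrderDual.toDual ∘ f) (OrderDual.toDual.injective.comp hf) r
  simpa only [Function.comp_assoc, strictMono_toDual_comp_iff] using h

/-- The signed sum over all permutations, i.e. the Pfaffian sum without the matching
conditions, with one bilinear form for each pair. -/
def signedPairSum {R : Type*} [CommRing R] {n : ℕ} (B : Fin n → Fin (2 * n) → Fin (2 * n) → R) :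
    R :=
  ∑ σ : Equiv.Perm (Fin (2 * n)),
    ((Equiv.Perm.sign σ : ℤ) : R) * ∏ k : Fin n, B k (σ (fe n k)) (σ (fo n k))

theorem swap_fe_fo_of_ne {n : ℕ} {a k : Fin n} (h : k ≠ a) :
    Equiv.swap (fe n a) (fo n a) (fe n k) = fe n k ∧
      Equiv.swap (fe n a) (fo n a) (fo n k) = fo n k :=
  ⟨Equiv.swap_apply_of_ne_of_ne ((fe_injective n).ne h) (fe_ne_fo n k a),
    Equiv.swap_apply_of_ne_of_ne (fe_ne_fo n a k).symm ((fo_injective n).ne h)⟩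

theorem signedPairSum_update_antisymm {R : Type*} [CommRing R] {n : ℕ}
    (B : Fin n → Fin (2 * n) → Fin (2 * n) → R) (a : Fin n) :
    signedPairSum (Function.update B a fun i j => B a i j - B a j i) = 2 * signedPairSum B := by
  have hsplit : ∀ (b : Fin (2 * n) → Fin (2 * n) → R) (σ : Equiv.Perm (Fin (2 * n))),
      ∏ k, Function.update B a b k (σ (fe n k)) (σ (fo n k)) =
        b (σ (fe n a)) (σ (fo n a)) *
          ∏ k ∈ Finset.univ.erase a, B k (σ (fe n k)) (σ (fo n k)) := by
    intro b σ
    rw [← Finset.mul_prod_erase _ _ (Finset.mem_univ a), Function.update_self]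
    congr 1
    refine Finset.prod_congr rfl fun k hk => ?_
    rw [Function.update_of_ne (Finset.ne_of_mem_erase hk)]
  have hswap : ∑ σ : Equiv.Perm (Fin (2 * n)), ((Equiv.Perm.sign σ : ℤ) : R) *
      (B a (σ (fo n a)) (σ (fe n a)) *
        ∏ k ∈ Finset.univ.erase a, B k (σ (fe n k)) (σ (fo n k))) = -signedPairSum B := by
    rw [signedPairSum, ← Finset.sum_neg_distrib,
      ← Equiv.sum_comp (Equiv.mulRight (Equiv.swap (fe n a) (fo n a)))]
    refine Finset.sum_congr rfl fun σ _ => ?_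
    rw [← Finset.mul_prod_erase _ _ (Finset.mem_univ a), ← neg_mul]
    congr 1
    · simp [Equiv.Perm.sign_swap (fe_ne_fo n a a)]
    · congr 1
      · simp
      · refine Finset.prod_congr rfl fun k hk => ?_
        have := swap_fe_fo_of_ne (Finset.ne_of_mem_erase hk)
        simp [this.1, this.2]
  have hself : ∑ σ : Equiv.Perm (Fin (2 * n)), ((Equiv.Perm.sign σ : ℤ) : R) *
      (B a (σ (fe n a)) (σ (fo n a)) *
        ∏ k ∈ Finset.univ.erase a, B k (σ (fe n k)) (σ (fo n k))) = signedPairSum B := by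
    rw [signedPairSum]
    refine Finset.sum_congr rfl fun σ _ => ?_
    rw [← Finset.mul_prod_erase _ _ (Finset.mem_univ a)]
  rw [signedPairSum]
  simp only [hsplit, sub_mul, mul_sub, Finset.sum_sub_distrib]
  rw [hswap, hself]
  ring

theorem signedPairSum_antisymm {R : Type*} [CommRing R] {n : ℕ}
    (B : Fin n → Fin (2 * n) → Fin (2 * n) → R) :
    signedPairSum (fun k i j => B k i j - B k j i) = 2 ^ n * signedPairSum B := by
  classical
  have key : ∀ s : Finset (Fin n),
      signedPairSum (fun k i j => if k ∈ s then B k i j - B k j i else B k i j) =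
        2 ^ s.card * signedPairSum B := by
    intro s
    induction s using Finset.induction_on with
    | empty => simp
    | insert a s ha ih =>
      rw [Finset.card_insert_of_notMem ha, pow_succ', mul_assoc, ← ih,
        ← signedPairSum_update_antisymm _ a]
      congr 1
      funext k i j
      rcases eq_or_ne k a with rfl | hk
      · simp [ha]
      · simp [hk]
  simpa using key Finset.univ

open Classical in
theorem signedPairSum_eq_pf {R : Type*} [CommRing R] {n : ℕ}
    (A : Matrix (Fin (2 * n)) (Fin (2 * n)) R) (hA : ∀ i j, A i j = -A j i) :
    signedPairSum (fun _ => A) = 2 ^ n * (n.factorial * pf A) := by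
  have h1 : signedPairSum (fun _ => A) =
      2 ^ n * signedPairSum fun (_ : Fin n) i j => if i < j then A i j else 0 := by
    rw [← signedPairSum_antisymm]
    refine Finset.sum_congr rfl fun σ _ => ?_
    congr 1
    refine Finset.prod_congr rfl fun k _ => ?_
    beta_reduce
    rcases lt_or_gt_of_ne (σ.injective.ne (fe_ne_fo n k k)) with h | h
    · simp [h, h.not_gt]
    · rw [if_neg h.not_gt, if_pos h, zero_sub]
      exact hA _ _
  rw [h1]
  congr 1
  set F : Equiv.Perm (Fin (2 * n)) → R := fun σ =>
    ((Equiv.Perm.sign σ : ℤ) : R) *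
      ∏ k : Fin n, if σ (fe n k) < σ (fo n k) then A (σ (fe n k)) (σ (fo n k)) else 0 with hF
  have hinv : ∀ (π : Equiv.Perm (Fin n)) σ, F (σ * pairPerm π) = F σ := by
    intro π σ
    simp only [hF, Equiv.Perm.sign_mul, sign_pairPerm, mul_one, Equiv.Perm.mul_apply,
      pairPerm_fe, pairPerm_fo]
    rw [Equiv.prod_comp π fun k => if σ (fe n k) < σ (fo n k) then A (σ (fe n k)) (σ (fo n k)) else 0]
  have hpf : pf A = ∑ σ, if StrictMono (fun k => σ (fe n k)) then F σ else 0 := by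
    rw [pf, Finset.sum_filter]
    refine Finset.sum_congr rfl fun σ _ => ?_
    by_cases h : ∀ k : Fin n, σ (fe n k) < σ (fo n k)
    · by_cases h' : StrictMono (fun k => σ (fe n k))
      · rw [if_pos ⟨h, fun k l hkl => h' hkl⟩, if_pos h']
        simp [hF, h]
      · rw [if_neg fun hh => h' fun k l hkl => hh.2 k l hkl, if_neg h']
    · rw [if_neg fun hh => h hh.1]
      push Not at h
      obtain ⟨k, hk⟩ := h
      have : F σ = 0 := by
        simp only [hF]
        rw [Finset.prod_eq_zero (Finset.mem_univ k) (if_neg hk.not_gt), mul_zero]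
      rw [this, ite_self]
  calc ∑ σ, F σ
      = ∑ σ, ∑ π : Equiv.Perm (Fin n),
          if StrictMono ((fun k => σ (fe n k)) ∘ π) then F σ else 0 := by
        refine Finset.sum_congr rfl fun σ _ => ?_
        exact (sum_perm_ite_strictMono _ (σ.injective.comp (fe_injective n)) (F σ)).symm
    _ = ∑ π : Equiv.Perm (Fin n), ∑ σ,
          if StrictMono (fun k => σ (fe n k)) then F σ else 0 := by
        rw [Finset.sum_comm]
        refine Finset.sum_congr rfl fun π _ => ?_
        rw [← Equiv.sum_comp (Equiv.mulRight (pairPerm π)) fun σ =>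
          if StrictMono (fun k => σ (fe n k)) then F σ else 0]
        refine Finset.sum_congr rfl fun σ _ => ?_
        simp only [Equiv.coe_mulRight, hinv, Equiv.Perm.mul_apply, pairPerm_fe]
        rfl
    _ = n.factorial * pf A := by
        rw [hpf, Finset.sum_const, Finset.card_univ, Fintype.card_perm, Fintype.card_fin,
          nsmul_eq_mul]

theorem hasSum_prod_fin {R ι : Type*} [NormedCommRing R] [CompleteSpace R] {n : ℕ}
    (f : Fin n → ι → R) (hf : ∀ k, Summable fun i => ‖f k i‖) :
    (Summable fun m : Fin n → ι => ‖∏ k, f k (m k)‖) ∧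
      HasSum (fun m : Fin n → ι => ∏ k, f k (m k)) (∏ k, ∑' i, f k i) := by
  induction n with
  | zero =>
    refine ⟨Summable.of_finite, ?_⟩
    simp [hasSum_unique]
  | succ n ih =>
    obtain ⟨h1, h2⟩ := ih (fun k => f k.succ) fun k => hf k.succ
    have hs : Summable fun p : ι × (Fin n → ι) => ‖f 0 p.1 * ∏ k : Fin n, f k.succ (p.2 k)‖ :=
      Summable.mul_norm (f := f 0) (g := fun m : Fin n → ι => ∏ k : Fin n, f k.succ (m k)) (hf 0) h1
    have hm : HasSum (fun p : ι × (Fin n → ι) => f 0 p.1 * ∏ k : Fin n, f k.succ (p.2 k))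
        ((∑' i, f 0 i) * ∏ k : Fin n, ∑' i, f k.succ i) :=
      HasSum.mul (f := f 0) (g := fun m : Fin n → ι => ∏ k : Fin n, f k.succ (m k))
        (Summable.of_norm (hf 0)).hasSum h2 hs.of_norm
    rw [← (Fin.consEquiv fun _ => ι).summable_iff, ← (Fin.consEquiv fun _ => ι).hasSum_iff]
    simp only [Function.comp_def, Fin.consEquiv_apply, Fin.prod_univ_succ, Fin.cons_zero,
      Fin.cons_succ]
    exact ⟨hs, hm⟩

/-- The alternant whose columns `2k` and `2k+1` carry the exponents `m k + 1` and `m k`. -/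
def pairAlternant {n : ℕ} (x : Fin (2 * n) → ℂ) (m : Fin n → ℕ) : ℂ :=
  signedPairSum fun k i j => x i ^ (m k + 1) * x j ^ m k

theorem det_eq_pairAlternant {n : ℕ} (x : Fin (2 * n) → ℂ) (m : Fin n → ℕ) (c : Fin (2 * n) → ℕ)
    (hc : ∀ k, c (fe n k) = m k + 1 ∧ c (fo n k) = m k) :
    (Matrix.of fun i j => x i ^ c j).det = pairAlternant x m := by
  rw [Matrix.det_apply', pairAlternant, signedPairSum]
  refine Finset.sum_congr rfl fun σ _ => ?_
  rw [prod_fin_two_mul]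
  simp [hc]

theorem pairAlternant_eq_det {n : ℕ} (x : Fin (2 * n) → ℂ) (m : Fin n → ℕ) :
    pairAlternant x m = (Matrix.of fun i j =>
      x i ^ (Sum.elim (fun k => m k + 1) m ((evenOddEquiv n).symm j))).det := by
  refine (det_eq_pairAlternant x m _ fun k => ?_).symm
  simp [← evenOddEquiv_inl, ← evenOddEquiv_inr]

theorem pairAlternant_eq_zero_of_eq {n : ℕ} (x : Fin (2 * n) → ℂ) (m : Fin n → ℕ) {a b : Fin n}
    (hab : a ≠ b) (h : m a = m b) : pairAlternant x m = 0 := by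
  rw [pairAlternant_eq_det]
  refine Matrix.det_zero_of_column_eq ((fe_injective n).ne hab) fun k => ?_
  simp [← evenOddEquiv_inl, h]

theorem pairAlternant_eq_zero_of_eq_succ {n : ℕ} (x : Fin (2 * n) → ℂ) (m : Fin n → ℕ)
    {a b : Fin n} (h : m a = m b + 1) : pairAlternant x m = 0 := by
  rw [pairAlternant_eq_det]
  refine Matrix.det_zero_of_column_eq (fe_ne_fo n b a) fun k => ?_
  simp [← evenOddEquiv_inl, ← evenOddEquiv_inr, h]

theorem pairAlternant_comp_perm {n : ℕ} (x : Fin (2 * n) → ℂ) (m : Fin n → ℕ)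
    (π : Equiv.Perm (Fin n)) : pairAlternant x (m ∘ π) = pairAlternant x m := by
  rw [pairAlternant, pairAlternant, signedPairSum, signedPairSum,
    ← Equiv.sum_comp (Equiv.mulRight (pairPerm π))]
  refine Finset.sum_congr rfl fun σ _ => ?_
  simp only [Equiv.coe_mulRight, Equiv.Perm.sign_mul, sign_pairPerm, mul_one,
    Equiv.Perm.mul_apply, pairPerm_fe, pairPerm_fo, Function.comp_apply]
  rw [Equiv.prod_comp π fun k => x (σ (fe n k)) ^ (m k + 1) * x (σ (fo n k)) ^ m k]

open Classical in
/-- Summing a symmetric function that vanishes on tuples with a repeated entry is `n!` times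
summing over strictly decreasing tuples. -/
theorem HasSum.strictAnti_of_symm {n : ℕ} {g : (Fin n → ℕ) → ℂ} {S : ℂ}
    (hg : HasSum g (n.factorial * S)) (hsymm : ∀ m (π : Equiv.Perm (Fin n)), g (m ∘ π) = g m)
    (hinj : ∀ m, ¬ Function.Injective m → g m = 0) :
    HasSum (fun m => if StrictAnti m then g m else 0) S := by
  have hs : Summable fun m => if StrictAnti m then g m else 0 := by
    refine (hg.summable.indicator {m | StrictAnti m}).congr fun m => ?_
    simp [Set.indicator_apply]
  obtain ⟨T, hT⟩ := hs
  have hcomp : ∀ π : Equiv.Perm (Fin n),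
      HasSum (fun m => if StrictAnti (m ∘ π) then g m else 0) T := by
    intro π
    have := (Equiv.arrowCongr π.symm (Equiv.refl ℕ)).hasSum_iff.mpr hT
    refine this.congr_fun fun m => ?_
    have he : Equiv.arrowCongr π.symm (Equiv.refl ℕ) m = m ∘ π := by
      funext k
      simp [Equiv.arrowCongr]
    simp only [Function.comp_apply, he, hsymm]
  have hsum := hasSum_sum fun π (_ : π ∈ Finset.univ) => hcomp π
  have hg' : (fun m => ∑ π : Equiv.Perm (Fin n), if StrictAnti (m ∘ π) then g m else 0) = g := by
    funext m
    by_cases hm : Function.Injective m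
    · exact sum_perm_ite_strictAnti m hm (g m)
    · simp [hinj m hm]
  rw [hg', Finset.sum_const, Finset.card_univ, Fintype.card_perm, Fintype.card_fin,
    nsmul_eq_mul] at hsum
  have : T = S := mul_left_cancel₀ (by exact_mod_cast n.factorial_ne_zero) (hsum.unique hg)
  exact this ▸ hT

theorem summable_and_hasSum_entry {a b t : ℂ} (ha : ‖a‖ < 1) (hb : ‖b‖ < 1) (ht : ‖t‖ < 1) :
    (Summable fun m : ℕ =>
        ‖(1 - t ^ (m + 1)) * (a ^ (m + 1) * b ^ m) - (1 - t ^ (m + 1)) * (b ^ (m + 1) * a ^ m)‖) ∧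
      HasSum (fun m : ℕ =>
          (1 - t ^ (m + 1)) * (a ^ (m + 1) * b ^ m) - (1 - t ^ (m + 1)) * (b ^ (m + 1) * a ^ m))
        ((a - b) * (1 - t) / ((1 - a * b) * (1 - t * (a * b)))) := by
  have hab : ‖a * b‖ < 1 := by
    rw [norm_mul]
    exact mul_lt_one_of_nonneg_of_lt_one_left (norm_nonneg _) ha hb.le
  have htab : ‖t * (a * b)‖ < 1 := by
    rw [norm_mul]
    exact mul_lt_one_of_nonneg_of_lt_one_left (norm_nonneg _) ht hab.le
  have hfun : (fun m : ℕ => (1 - t ^ (m + 1)) * (a ^ (m + 1) * b ^ m) -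
      (1 - t ^ (m + 1)) * (b ^ (m + 1) * a ^ m)) =
      fun m => (a - b) * ((a * b) ^ m - t * (t * (a * b)) ^ m) := by
    funext m
    simp only [mul_pow]
    ring
  have hsum : HasSum (fun m : ℕ => (a - b) * ((a * b) ^ m - t * (t * (a * b)) ^ m))
      ((a - b) * ((1 - a * b)⁻¹ - t * (1 - t * (a * b))⁻¹)) :=
    ((hasSum_geometric_of_norm_lt_one hab).sub
      ((hasSum_geometric_of_norm_lt_one htab).mul_left t)).mul_left (a - b)
  refine ⟨?_, ?_⟩
  · rw [← hfun] at hsum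
    exact hsum.summable.norm
  · rw [hfun]
    convert hsum using 1
    have h1 : 1 - a * b ≠ 0 := fun h => by
      rw [← sub_eq_zero.mp h, norm_one] at hab
      exact lt_irrefl _ hab
    have h2 : 1 - t * (a * b) ≠ 0 := fun h => by
      rw [← sub_eq_zero.mp h, norm_one] at htab
      exact lt_irrefl _ htab
    rw [← div_eq_mul_inv, inv_eq_one_div, div_sub_div _ _ h1 h2, mul_div_assoc]
    congr 2
    ring

theorem hasSum_mul_pairAlternant {n : ℕ} (x : Fin (2 * n) → ℂ) (t : ℂ) (hx : ∀ i, ‖x i‖ < 1)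
    (ht : ‖t‖ < 1) :
    HasSum (fun m : Fin n → ℕ => (∏ k, (1 - t ^ (m k + 1))) * pairAlternant x m)
      (n.factorial * pf (Matrix.of fun i j : Fin (2 * n) =>
        (x i - x j) * (1 - t) / ((1 - x i * x j) * (1 - t * (x i * x j))))) := by
  set A : Matrix (Fin (2 * n)) (Fin (2 * n)) ℂ := Matrix.of fun i j =>
    (x i - x j) * (1 - t) / ((1 - x i * x j) * (1 - t * (x i * x j))) with hAdef
  have hA : ∀ i j, A i j = -A j i := by
    intro i j
    simp only [hAdef, Matrix.of_apply]
    rw [← neg_div, mul_comm (x j) (x i)]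
    congr 1
    ring
  have hsum : HasSum (fun m : Fin n → ℕ => signedPairSum fun k i j =>
      (1 - t ^ (m k + 1)) * (x i ^ (m k + 1) * x j ^ m k) -
        (1 - t ^ (m k + 1)) * (x j ^ (m k + 1) * x i ^ m k))
      (signedPairSum fun (_ : Fin n) => A) := by
    refine hasSum_sum fun σ _ => HasSum.mul_left _ ?_
    have h := (hasSum_prod_fin (fun (k : Fin n) (m : ℕ) =>
      (1 - t ^ (m + 1)) * (x (σ (fe n k)) ^ (m + 1) * x (σ (fo n k)) ^ m) -
        (1 - t ^ (m + 1)) * (x (σ (fo n k)) ^ (m + 1) * x (σ (fe n k)) ^ m))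
      fun k => (summable_and_hasSum_entry (hx _) (hx _) ht).1).2
    simp only [(summable_and_hasSum_entry (hx _) (hx _) ht).2.tsum_eq] at h
    exact h
  rw [signedPairSum_eq_pf A hA] at hsum
  have h2 : (2 : ℂ) ^ n ≠ 0 := pow_ne_zero _ two_ne_zero
  rw [← hasSum_mul_left_iff h2]
  refine hsum.congr_fun fun m => ?_
  rw [signedPairSum_antisymm fun k i j => (1 - t ^ (m k + 1)) * (x i ^ (m k + 1) * x j ^ m k)]
  congr 1
  simp only [pairAlternant, signedPairSum, Finset.mul_sum, Finset.prod_mul_distrib]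
  refine Finset.sum_congr rfl fun σ _ => ?_
  ring

/-- The exponents in the odd columns of the alternant attached to a partition. -/
def oddExponents {n : ℕ} (l : Fin (2 * n) → ℕ) (k : Fin n) : ℕ :=
  l (fo n k) + (2 * n - 2 - 2 * (k : ℕ))

theorem oddExponents_strictAnti {n : ℕ} {l : Fin (2 * n) → ℕ} (hl : Antitone l) :
    StrictAnti (oddExponents l) := by
  intro a b hab
  have h : l (fo n b) ≤ l (fo n a) := hl (Fin.mk_le_mk.mpr (by
    have : (a : ℕ) < b := hab
    omega))
  have : (a : ℕ) < b := hab
  have := b.isLt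
  simp only [oddExponents]
  omega

theorem add_two_mul_le_of_strictAnti {n : ℕ} {m : Fin n → ℕ} (hm : StrictAnti m)
    (hgap : ∀ a b, m a ≠ m b + 1) {a b : Fin n} (hab : a ≤ b) :
    m b + 2 * (b : ℕ) ≤ m a + 2 * (a : ℕ) := by
  obtain ⟨b, hb⟩ := b
  induction b with
  | zero =>
    have : a = ⟨0, hb⟩ := le_antisymm hab (Fin.mk_le_mk.mpr (Nat.zero_le _))
    rw [this]
  | succ b ih =>
    rcases hab.eq_or_lt with rfl | h
    · exact le_rfl
    · have hlt : (a : ℕ) < b + 1 := h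
      have h1 := ih (by omega) (Fin.mk_le_mk.mpr (by omega))
      have h2 : m ⟨b + 1, hb⟩ < m ⟨b, by omega⟩ := hm (Fin.mk_lt_mk.mpr (by omega))
      have h3 := hgap ⟨b, by omega⟩ ⟨b + 1, hb⟩
      simp only at h1 ⊢
      omega

theorem exists_oddExponents_eq {n : ℕ} {m : Fin n → ℕ} (hm : StrictAnti m)
    (hgap : ∀ a b, m a ≠ m b + 1) :
    ∃ l : Fin (2 * n) → ℕ,
      (Antitone l ∧ ∀ k : Fin n, l (fe n k) = l (fo n k)) ∧ oddExponents l = m := by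
  have hval : ∀ k : Fin n, 2 * n - 2 - 2 * (k : ℕ) ≤ m k := by
    intro k
    have hk := k.isLt
    have h := add_two_mul_le_of_strictAnti hm hgap
      (show k ≤ ⟨n - 1, by omega⟩ from Fin.mk_le_mk.mpr (by omega))
    simp only at h
    omega
  refine ⟨fun i => m ⟨i / 2, by omega⟩ - (2 * n - 2 - 2 * ((i : ℕ) / 2)), ⟨?_, ?_⟩, ?_⟩
  · intro i j hij
    have hij' : (i : ℕ) ≤ j := hij
    have hj := j.isLt
    have h := add_two_mul_le_of_strictAnti hm hgap
      (show (⟨i / 2, by omega⟩ : Fin n) ≤ ⟨j / 2, by omega⟩ from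
        Fin.mk_le_mk.mpr (by omega))
    simp only at h ⊢
    omega
  · intro k
    have h1 : 2 * (k : ℕ) / 2 = k := by omega
    have h2 : (2 * (k : ℕ) + 1) / 2 = k := by omega
    simp only [fe, fo, h1, h2]
  · funext k
    have h2 : (2 * (k : ℕ) + 1) / 2 = k := by omega
    have := hval k
    simp only [oddExponents, fo, h2, Fin.eta]
    omega

theorem schurPoly_eq_pairAlternant {n : ℕ} (x : Fin (2 * n) → ℂ) {l : Fin (2 * n) → ℕ}
    (hl : ∀ k : Fin n, l (fe n k) = l (fo n k)) :
    schurPoly l x = pairAlternant x (oddExponents l) / vprod x := by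
  rw [schurPoly, det_eq_pairAlternant x (oddExponents l)]
  intro k
  have := k.isLt
  rw [hl]
  simp only [oddExponents, fe, fo]
  omega

/-- **Refined Littlewood identity for Schur polynomials** (Theorem 4):
`Σ_{λ' even} ∏_{i=2,4,…,2n} (1 - t^{λᵢ-i+2n+1}) s_λ(x₁,…,x_{2n})
  = Δ(x)_{2n}⁻¹ · Pf[(xᵢ-xⱼ)(1-t)/((1-xᵢxⱼ)(1-t xᵢxⱼ))]`,
the sum being over partitions `λ` with `ℓ(λ) ≤ 2n` and even conjugate, i.e.
`λ_{2k-1} = λ_{2k}` for all `k`.  It is stated here for complex values of the variables in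
a domain of convergence. -/
theorem refined_littlewood_schur (n : ℕ) (hn : 1 ≤ n) (x : Fin (2 * n) → ℂ) (t : ℂ)
    (hx : ∀ i, ‖x i‖ < 1 / (16 * n)) (ht : ‖t‖ < 1) (hxinj : Function.Injective x) :
    HasSum
      (fun l : {l : Fin (2 * n) → ℕ //
          Antitone l ∧ ∀ k : Fin n, l (fe n k) = l (fo n k)} =>
        (∏ k : Fin n, (1 - t ^ (l.1 (fo n k) + (2 * n - (2 * (k : ℕ) + 1))))) *
          schurPoly l.1 x)
      ((vprod x)⁻¹ *
        pf (Matrix.of fun i j : Fin (2 * n) =>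
          (x i - x j) * (1 - t) / ((1 - x i * x j) * (1 - t * (x i * x j))))) := by
  classical
  have hx1 : ∀ i, ‖x i‖ < 1 := by
    intro i
    refine (hx i).trans_le ?_
    have : (1 : ℝ) ≤ n := by exact_mod_cast hn
    rw [div_le_one (by linarith)]
    linarith
  have hstrict := (hasSum_mul_pairAlternant x t hx1 ht).strictAnti_of_symm
    (fun m π => by
      rw [pairAlternant_comp_perm]
      congr 1
      exact Equiv.prod_comp π fun k => 1 - t ^ (m k + 1))
    (fun m hm => by
      simp only [Function.Injective, not_forall] at hm
      obtain ⟨a, b, h, hab⟩ := hm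
      rw [pairAlternant_eq_zero_of_eq x m hab h, mul_zero])
  have hinj : Function.Injective (fun l : {l : Fin (2 * n) → ℕ //
      Antitone l ∧ ∀ k : Fin n, l (fe n k) = l (fo n k)} => oddExponents l.1) := by
    intro l l' h
    have hfo : ∀ k, l.1 (fo n k) = l'.1 (fo n k) := fun k =>
      Nat.add_right_cancel (congrFun h k)
    refine Subtype.ext (funext (forall_fin_two_mul.mpr fun k => ⟨?_, hfo k⟩))
    rw [l.2.2, l'.2.2, hfo]
  rw [← hinj.hasSum_iff] at hstrict
  · refine (hstrict.mul_left (vprod x)⁻¹).congr_fun fun l => ?_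
    rw [Function.comp_apply, if_pos (oddExponents_strictAnti l.2.1),
      schurPoly_eq_pairAlternant x l.2.2]
    have hexp : ∀ k : Fin n, l.1 (fo n k) + (2 * n - (2 * (k : ℕ) + 1)) =
        oddExponents l.1 k + 1 := by
      intro k
      have := k.isLt
      simp only [oddExponents]
      omega
    simp only [hexp]
    ring
  · intro m hm
    by_cases hanti : StrictAnti m
    · rw [if_pos hanti]
      by_cases hgap : ∀ a b, m a ≠ m b + 1
      · obtain ⟨l, hl, rfl⟩ := exists_oddExponents_eq hanti hgap
        exact absurd ⟨⟨l, hl⟩, rfl⟩ hm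
      · push Not at hgap
        obtain ⟨a, b, h⟩ := hgap
        rw [pairAlternant_eq_zero_of_eq_succ x m h, mul_zero]
    · exact if_neg hanti
end
end

section
/- (Laksov–Lascoux–Thorup, Stembridge.) For indeterminates x_1,…,x_{2n}, Pf[ (x_i − x_j)/(1 − x_i x_j) ]_{1≤i<j≤2n} = ∏_{1≤i<j≤2n} (x_i − x_j)/(1 − x_i x_j), as an identity of rational functions. -/
noncomputable section

open scoped BigOperators

open Finset Polynomial in
/-- Partial fractions: the residues of
`(z - u) ∏ₖ (1 - u yₖ) / ((1 - z u) (1 - u²) ∏ₖ (u - yₖ))` sum to zero. -/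
theorem prod_div_eq_sum_residues {L ι : Type*} [Field L] [Fintype ι] [DecidableEq ι]
    (hodd : Odd (Fintype.card ι)) (h2 : (2 : L) ≠ 0) (z : L) (y : ι → L)
    (hz : z ≠ 0) (hz2 : z * z ≠ 1) (hzy : ∀ i, z * y i ≠ 1) (hy : Function.Injective y)
    (hyy : ∀ i, y i * y i ≠ 1) :
    ∏ j, (z - y j) / (1 - z * y j) =
      ∑ j, (z - y j) / (1 - z * y j) *
        ∏ k ∈ univ.erase j, (1 - y j * y k) / (y j - y k) := by
  classical
  let v : Option (Option (Option ι)) → L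
    | none => 1
    | some none => -1
    | some (some none) => z⁻¹
    | some (some (some i)) => y i
  let P : L[X] := (C z - X) * ∏ k, (1 - X * C (y k))
  have hz1 : z ≠ 1 := by rintro rfl; simp at hz2
  have hz1' : z ≠ -1 := by rintro rfl; simp at hz2
  have hy1 : ∀ i, y i ≠ 1 := fun i h => hyy i (by simp [h])
  have hy1' : ∀ i, y i ≠ -1 := fun i h => hyy i (by simp [h])
  have hm1 : (1 : L) ≠ -1 := fun h => h2 (by linear_combination h)
  have hyz : ∀ i, y i ≠ z⁻¹ := fun i h => hzy i (by rw [h, mul_inv_cancel₀ hz])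
  have hzi1 : z⁻¹ ≠ 1 := fun h => hz1 (by simpa using h)
  have hzi1' : z⁻¹ ≠ -1 := fun h => hz1' (by rw [← inv_inv z, h]; norm_num)
  have hv : Function.Injective v := by
    rintro (_ | _ | _ | i) (_ | _ | _ | j) h <;>
      simp only [v] at h <;> first | rfl | (exfalso; grind) | (rw [hy h])
  have hdeg : P.degree < (#(univ : Finset (Option (Option (Option ι)))) - 1 : ℕ) := by
    have h1 : (C z - X : L[X]).natDegree ≤ 1 := by compute_degree
    have h3 : (∏ k, (1 - X * C (y k)) : L[X]).natDegree ≤ Fintype.card ι := by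
      refine (natDegree_prod_le _ _).trans ?_
      refine (sum_le_card_nsmul _ _ 1 fun i _ => ?_).trans (by simp)
      compute_degree
    have h4 : P.natDegree ≤ 1 + Fintype.card ι :=
      natDegree_mul_le.trans (Nat.add_le_add h1 h3)
    refine lt_of_le_of_lt degree_le_natDegree ?_
    rw [Nat.cast_lt]
    simp
    omega
  have key := Lagrange.coeff_eq_sum (s := univ) (v := v) hv.injOn (P := P)
    (hdeg.trans_le (by exact_mod_cast Nat.sub_le _ _))
  rw [coeff_eq_zero_of_degree_lt hdeg] at key
  have herase : ∀ i, ∏ j ∈ univ.erase i, (v i - v j) = ∏ j, if j = i then 1 else v i - v j := by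
    intro i
    rw [← mul_prod_erase univ (fun j => if j = i then 1 else v i - v j) (mem_univ i)]
    simp only [if_true, one_mul]
    exact prod_congr rfl fun j hj => by rw [if_neg (ne_of_mem_erase hj)]
  have herase' : ∀ i, ∏ j ∈ univ.erase i, (y i - y j) = ∏ j, if j = i then 1 else y i - y j := by
    intro i
    rw [← mul_prod_erase univ (fun j => if j = i then 1 else y i - y j) (mem_univ i)]
    simp only [if_true, one_mul]
    exact prod_congr rfl fun j hj => by rw [if_neg (ne_of_mem_erase hj)]
  have hP : ∀ u, P.eval u = (z - u) * ∏ k, (1 - u * y k) := by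
    intro u; simp only [P, eval_mul, eval_sub, eval_C, eval_X, eval_prod, eval_one]
  simp only [herase, Fintype.sum_option, Fintype.prod_option, hP, v, reduceCtorEq,
    if_true, if_false, one_mul, Option.some.injEq] at key
  have hm : (-1 : L) ^ Fintype.card ι = -1 := hodd.neg_one_pow
  have n1 : ∏ k, (1 - y k) ≠ 0 := prod_ne_zero_iff.2 fun i _ => sub_ne_zero.2 (hy1 i).symm
  have e2 : ∏ k, (1 - -1 * y k) = - ∏ k, (-1 - y k) := by
    have : ∏ k, (1 - -1 * y k) = ∏ k, (-1) * (-1 - y k) := prod_congr rfl fun i _ => by ring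
    rw [this, prod_mul_distrib, prod_const, card_univ, hm, neg_one_mul]
  have n2 : ∏ k, (-1 - y k) ≠ 0 := prod_ne_zero_iff.2 fun i _ => sub_ne_zero.2 (hy1' i).symm
  have n3 : ∏ k, (z⁻¹ - y k) ≠ 0 := prod_ne_zero_iff.2 fun i _ => sub_ne_zero.2 (hyz i).symm
  have e3 : ∏ k, (1 - z⁻¹ * y k) = (∏ k, (z - y k) / (1 - z * y k)) * ∏ k, (z⁻¹ - y k) := by
    rw [← prod_mul_distrib]
    refine prod_congr rfl fun i _ => ?_
    have := sub_ne_zero.2 (hzy i).symm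
    field_simp
  have e4 : ∀ j, (z - y j) * (∏ k, (1 - y j * y k)) / ((y j - 1) * ((y j - -1) * ((y j - z⁻¹) *
      ∏ k, if k = j then 1 else y j - y k))) = z * ((z - y j) / (1 - z * y j) *
        ∏ k ∈ univ.erase j, (1 - y j * y k) / (y j - y k)) := by
    intro j
    rw [← herase' j, ← mul_prod_erase univ _ (mem_univ j), prod_div_distrib]
    have n4 : ∏ k ∈ univ.erase j, (y j - y k) ≠ 0 :=
      prod_ne_zero_iff.2 fun k hk => sub_ne_zero.2 (hy.ne (ne_of_mem_erase hk).symm)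
    have n5 := sub_ne_zero.2 (hzy j).symm
    have n6 := sub_ne_zero.2 (hy1 j)
    have n7 := sub_ne_zero.2 (hy1' j)
    have n8 := sub_ne_zero.2 (hyz j)
    have n9 : y j * z - 1 ≠ 0 := fun h => n5 (by linear_combination -h)
    have n10 : y j - z⁻¹ = -(1 - z * y j) / z := by field_simp; ring
    rw [n10]
    field_simp
    ring
  simp only [e4, ← mul_sum, e2, e3] at key
  have r1 : ((z - 1) * ∏ k, (1 - y k)) / ((1 - -1) * ((1 - z⁻¹) * ∏ k, (1 - y k))) = z / 2 := by
    have := sub_ne_zero.2 hz1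
    have h3 : 1 - z⁻¹ = (z - 1) / z := by field_simp
    rw [h3, sub_neg_eq_add, one_add_one_eq_two]
    field_simp
  have r2 : ((z - -1) * -∏ k, (-1 - y k)) / ((-1 - 1) * ((-1 - z⁻¹) * ∏ k, (-1 - y k))) =
      -(z / 2) := by
    have h3 := sub_ne_zero.2 hz1'
    have h4 : (-1 - z⁻¹) = -((z - -1) / z) := by field_simp; ring
    have h5 : (-1 - 1 : L) = -2 := by norm_num
    rw [h4, h5]
    field_simp
  have r3 : ∀ F : L, ((z - z⁻¹) * (F * ∏ k, (z⁻¹ - y k))) /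
      ((z⁻¹ - 1) * ((z⁻¹ - -1) * ∏ k, (z⁻¹ - y k))) = -(z * F) := by
    intro F
    have h3 := sub_ne_zero.2 hz1'
    have h4 := sub_ne_zero.2 hz1
    have h5 : z⁻¹ - 1 = -((z - 1) / z) := by field_simp; ring
    have h6 : z⁻¹ - -1 = (z - -1) / z := by field_simp; ring
    have h7 : z - z⁻¹ = (z - 1) * (z - -1) / z := by field_simp; ring
    rw [h5, h6, h7]
    generalize ∏ k, (z⁻¹ - y k) = Q at n3
    field_simp
  rw [r1, r2, r3] at key
  exact mul_left_cancel₀ hz (by linear_combination key)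

/-- Isolating the index `p` in a product over pairs `i < j`. -/
theorem prod_Ioi_succAbove {M : Type*} [CommMonoid M] {m : ℕ} (f : Fin (m + 1) → Fin (m + 1) → M)
    (hf : ∀ i j, f i j = f j i) (p : Fin (m + 1)) :
    ∏ i, ∏ j ∈ Finset.Ioi i, f i j =
      (∏ i, f p (p.succAbove i)) *
        ∏ i : Fin m, ∏ j ∈ Finset.Ioi i, f (p.succAbove i) (p.succAbove j) := by
  have key : ∀ (k : ℕ) (g : Fin k → Fin k → M),
      ∏ i, ∏ j ∈ Finset.Ioi i, g i j = ∏ i, ∏ j, if i < j then g i j else 1 := by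
    intro k g
    refine Finset.prod_congr rfl fun i _ => ?_
    rw [← Finset.prod_filter]
    refine Finset.prod_congr ?_ fun _ _ => rfl
    ext; simp
  rw [key, key, Fin.prod_univ_succAbove _ p, Fin.prod_univ_succAbove _ p]
  simp only [Fin.prod_univ_succAbove _ p, lt_irrefl, if_false, one_mul,
    Fin.succAbove_lt_succAbove_iff, Finset.prod_mul_distrib]
  rw [← mul_assoc, ← Finset.prod_mul_distrib]
  congr 1
  refine Finset.prod_congr rfl fun i _ => ?_
  rcases lt_or_gt_of_ne (Fin.succAbove_ne p i) with h | h
  · simp [h, h.not_gt, hf]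
  · simp [h, h.not_gt]

/-- Isolating the index `p` in an alternating product over pairs `i < j`. -/
theorem prod_Ioi_succAbove_of_antisymm {R : Type*} [CommRing R] {m : ℕ}
    (f : Fin (m + 1) → Fin (m + 1) → R) (hf : ∀ i j, f i j = -f j i) (p : Fin (m + 1)) :
    ∏ i, ∏ j ∈ Finset.Ioi i, f i j =
      (-1) ^ (p : ℕ) * (∏ i, f p (p.succAbove i)) *
        ∏ i : Fin m, ∏ j ∈ Finset.Ioi i, f (p.succAbove i) (p.succAbove j) := by
  have h := Equiv.Perm.prod_Ioi_comp_eq_sign_mul_prod p.cycleRange.symm hf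
  rw [Fin.prod_univ_succ, Fin.prod_Ioi_zero] at h
  simp only [Fin.prod_Ioi_succ, Fin.cycleRange_symm_zero, Fin.cycleRange_symm_succ,
    Equiv.Perm.sign_symm, Fin.sign_cycleRange] at h
  rw [mul_assoc, h, ← mul_assoc]
  push_cast
  rw [← mul_pow]
  simp

theorem sum_mul_prod_sub_of_generic {L : Type*} [Field L] {m : ℕ} (hm : Even m) (h2 : (2 : L) ≠ 0)
    (z : L) (y : Fin (m + 1) → L)
    (hz : z ≠ 0) (hz2 : z * z ≠ 1) (hzy : ∀ i, z * y i ≠ 1) (hy : Function.Injective y)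
    (hyy : ∀ i, y i * y i ≠ 1) :
    ∑ p : Fin (m + 1), (-1) ^ (p : ℕ) * (z - y p) *
      (∏ i, (1 - z * y (p.succAbove i)) * (1 - y p * y (p.succAbove i))) *
      (∏ i : Fin m, ∏ j ∈ Finset.Ioi i, (y (p.succAbove i) - y (p.succAbove j))) =
    (∏ p, (z - y p)) * ∏ i, ∏ j ∈ Finset.Ioi i, (y i - y j) := by
  have h := prod_div_eq_sum_residues (by simpa using hm.add_one) h2 z y hz hz2 hzy hy hyy
  have n0 : ∏ j, (1 - z * y j) ≠ 0 :=
    Finset.prod_ne_zero_iff.2 fun i _ => sub_ne_zero.2 (hzy i).symm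
  rw [Finset.prod_div_distrib, div_eq_iff n0] at h
  rw [h, Finset.sum_mul, Finset.sum_mul]
  refine Finset.sum_congr rfl fun p _ => ?_
  rw [prod_Ioi_succAbove_of_antisymm (fun i j => y i - y j) (fun i j => by ring) p,
    Fin.prod_univ_succAbove _ p, Finset.prod_mul_distrib, Finset.prod_div_distrib]
  have e : ∀ g : Fin (m + 1) → L, ∏ k ∈ Finset.univ.erase p, g k = ∏ i, g (p.succAbove i) := by
    intro g
    rw [← Finset.compl_singleton, ← Fin.image_succAbove_univ,
      Finset.prod_image Fin.succAbove_right_injective.injOn]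
  rw [e, e]
  have n1 : ∏ i, (y p - y (p.succAbove i)) ≠ 0 :=
    Finset.prod_ne_zero_iff.2 fun i _ => sub_ne_zero.2 (hy.ne (Fin.succAbove_ne p i).symm)
  have n2 := sub_ne_zero.2 (hzy p).symm
  field_simp

theorem sum_mul_prod_sub {R : Type*} [CommRing R] {m : ℕ} (hm : Even m) (z : R)
    (y : Fin (m + 1) → R) :
    ∑ p : Fin (m + 1), (-1) ^ (p : ℕ) * (z - y p) *
      (∏ i, (1 - z * y (p.succAbove i)) * (1 - y p * y (p.succAbove i))) *
      (∏ i : Fin m, ∏ j ∈ Finset.Ioi i, (y (p.succAbove i) - y (p.succAbove j))) =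
    (∏ p, (z - y p)) * ∏ i, ∏ j ∈ Finset.Ioi i, (y i - y j) := by
  let P := MvPolynomial (Option (Fin (m + 1))) ℤ
  let X : Option (Fin (m + 1)) → P := MvPolynomial.X
  let φ := algebraMap P (FractionRing P)
  have hφ : Function.Injective φ := IsFractionRing.injective P (FractionRing P)
  have hX : ∀ i j, φ (X i) * φ (X j) ≠ 1 := by
    intro i j h
    rw [← map_mul, ← map_one φ] at h
    have := congrArg (MvPolynomial.eval (fun _ => (0 : ℤ))) (hφ h)
    simp [X] at this
  have h2 : (2 : FractionRing P) ≠ 0 := fun h =>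
    two_ne_zero (α := P) (hφ ((map_ofNat φ 2).trans (h.trans (map_zero φ).symm)))
  have h := sum_mul_prod_sub_of_generic hm h2 (φ (X none)) (fun i => φ (X (some i)))
    (fun h => MvPolynomial.X_ne_zero (R := ℤ) none (hφ (h.trans (map_zero φ).symm))) (hX _ _)
    (fun i => hX _ _)
    (fun i j h => Option.some_injective _ (MvPolynomial.X_injective (hφ h))) (fun i => hX _ _)
  have h' : ∑ p : Fin (m + 1), (-1) ^ (p : ℕ) * (X none - X (some p)) *
      (∏ i, (1 - X none * X (some (p.succAbove i))) *
        (1 - X (some p) * X (some (p.succAbove i)))) *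
      (∏ i : Fin m, ∏ j ∈ Finset.Ioi i, (X (some (p.succAbove i)) - X (some (p.succAbove j)))) =
      (∏ p, (X none - X (some p))) * ∏ i, ∏ j ∈ Finset.Ioi i, (X (some i) - X (some j)) := by
    apply hφ
    simpa only [map_sum, map_mul, map_prod, map_sub, map_one, map_pow, map_neg] using h
  have h'' := congrArg (MvPolynomial.eval₂Hom (Int.castRingHom R) (fun o => o.elim z y)) h'
  simpa only [map_sum, map_mul, map_prod, map_sub, map_one, map_pow, map_neg, X,
    MvPolynomial.eval₂Hom_X', Option.elim] using h''

/-- The product formula satisfies the recursion given by expanding a Pfaffian along its first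
row. -/
theorem sum_mul_prod_sub_div {K : Type*} [Field K] {m : ℕ} (hm : Even m)
    (x : Fin (m + 2) → K) (h : ∀ i j, i ≠ j → x i * x j ≠ 1) :
    ∑ p : Fin (m + 1), (-1) ^ (p : ℕ) * ((x 0 - x p.succ) / (1 - x 0 * x p.succ)) *
      (∏ i : Fin m, ∏ j ∈ Finset.Ioi i, (x (p.succAbove i).succ - x (p.succAbove j).succ) /
        (1 - x (p.succAbove i).succ * x (p.succAbove j).succ)) =
    ∏ i, ∏ j ∈ Finset.Ioi i, (x i - x j) / (1 - x i * x j) := by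
  have hne : ∀ i j, i ≠ j → 1 - x i * x j ≠ 0 := fun i j hij => sub_ne_zero.2 (h i j hij).symm
  rw [Fin.prod_univ_succ, Fin.prod_Ioi_zero]
  simp only [Fin.prod_Ioi_succ, Finset.prod_div_distrib]
  rw [div_mul_div_comm, ← sum_mul_prod_sub hm (x 0) (fun i => x i.succ), Finset.sum_div]
  refine Finset.sum_congr rfl fun p _ => ?_
  rw [prod_Ioi_succAbove (fun i j : Fin (m + 1) => 1 - x i.succ * x j.succ)
    (fun i j => by ring) p, Fin.prod_univ_succAbove _ p, Finset.prod_mul_distrib]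
  have n1 := hne 0 p.succ (Fin.succ_ne_zero p).symm
  have n2 : ∏ i, (1 - x 0 * x (p.succAbove i).succ) ≠ 0 :=
    Finset.prod_ne_zero_iff.2 fun i _ => hne _ _ (Fin.succ_ne_zero _).symm
  have n3 : ∏ i, (1 - x p.succ * x (p.succAbove i).succ) ≠ 0 :=
    Finset.prod_ne_zero_iff.2 fun i _ =>
      hne _ _ ((Fin.succ_injective _).ne (Fin.succAbove_ne p i).symm)
  have n4 : ∏ i : Fin m, ∏ j ∈ Finset.Ioi i,
      (1 - x (p.succAbove i).succ * x (p.succAbove j).succ) ≠ 0 :=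
    Finset.prod_ne_zero_iff.2 fun i _ => Finset.prod_ne_zero_iff.2 fun j hj =>
      hne _ _ ((Fin.succ_injective _).ne (Fin.succAbove_right_injective.ne
        (Finset.mem_Ioi.1 hj).ne))
  field_simp

/-- The permutation of `Fin (m + 2)` with first values `0`, `p + 1`, acting on the remaining
positions as `ρ` does on the remaining values. -/
def consPairPerm {m : ℕ} (p : Fin (m + 1)) (ρ : Equiv.Perm (Fin m)) : Equiv.Perm (Fin (m + 2)) :=
  Equiv.Perm.decomposeFin.symm (0, p.cycleRange.symm * Equiv.Perm.decomposeFin.symm (0, ρ))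

theorem consPairPerm_zero {m : ℕ} (p : Fin (m + 1)) (ρ : Equiv.Perm (Fin m)) :
    consPairPerm p ρ 0 = 0 := by
  simp [consPairPerm]

theorem consPairPerm_one {m : ℕ} (p : Fin (m + 1)) (ρ : Equiv.Perm (Fin m)) :
    consPairPerm p ρ 1 = p.succ := by
  simp [consPairPerm, Equiv.Perm.decomposeFin_symm_apply_one]

theorem consPairPerm_succ_succ {m : ℕ} (p : Fin (m + 1)) (ρ : Equiv.Perm (Fin m)) (i : Fin m) :
    consPairPerm p ρ i.succ.succ = (p.succAbove (ρ i)).succ := by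
  simp [consPairPerm, Equiv.Perm.decomposeFin_symm_apply_succ]

theorem sign_consPairPerm {m : ℕ} (p : Fin (m + 1)) (ρ : Equiv.Perm (Fin m)) :
    Equiv.Perm.sign (consPairPerm p ρ) = (-1) ^ (p : ℕ) * Equiv.Perm.sign ρ := by
  simp [consPairPerm, Equiv.Perm.decomposeFin.symm_sign, Fin.sign_cycleRange]

theorem consPairPerm_injective {m : ℕ} :
    Function.Injective
      (fun q : Fin (m + 1) × Equiv.Perm (Fin m) => consPairPerm q.1 q.2) := by
  rintro ⟨p, ρ⟩ ⟨p', ρ'⟩ h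
  have hp : p = p' := by
    have := Equiv.congr_fun h 1
    simpa [consPairPerm_one] using this
  subst hp
  have hρ : ρ = ρ' := by
    ext i : 1
    have := Equiv.congr_fun h i.succ.succ
    simpa [consPairPerm_succ_succ] using this
  rw [hρ]

theorem exists_consPairPerm_eq {m : ℕ} (σ : Equiv.Perm (Fin (m + 2))) (h0 : σ 0 = 0) :
    ∃ p ρ, consPairPerm p ρ = σ := by
  have key : ∀ {k : ℕ} (τ : Equiv.Perm (Fin (k + 1))), τ 0 = 0 →
      ∃ ρ, Equiv.Perm.decomposeFin.symm (0, ρ) = τ := by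
    intro k τ hτ
    refine ⟨(Equiv.Perm.decomposeFin τ).2, ?_⟩
    rw [Equiv.symm_apply_eq]
    refine Prod.ext ?_ rfl
    rw [← hτ, ← Equiv.Perm.decomposeFin_symm_apply_zero (Equiv.Perm.decomposeFin τ).1
      (Equiv.Perm.decomposeFin τ).2]
    simp
  obtain ⟨τ, rfl⟩ := key σ h0
  obtain ⟨ρ, hρ⟩ := key ((τ 0).cycleRange * τ) (by simp)
  refine ⟨τ 0, ρ, ?_⟩
  rw [consPairPerm, hρ]
  congr 2
  ext i : 1
  simp

/-- Expansion of the Pfaffian along the first row. -/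
theorem pf_succ {R : Type*} [CommRing R] {n : ℕ}
    (A : Matrix (Fin (2 * (n + 1))) (Fin (2 * (n + 1))) R) :
    pf A = ∑ p : Fin (2 * n + 1), (-1) ^ (p : ℕ) * A (0 : Fin (2 * n + 2)) p.succ *
      pf (A.submatrix (fun i : Fin (2 * n) => (p.succAbove i).succ)
        (fun i : Fin (2 * n) => (p.succAbove i).succ)) := by
  have fe0 : fe (n + 1) 0 = (0 : Fin (2 * n + 2)) := rfl
  have fo0 : fo (n + 1) 0 = (1 : Fin (2 * n + 2)) := rfl
  have feS : ∀ k : Fin n, fe (n + 1) k.succ = ((fe n k).succ.succ : Fin (2 * n + 2)) :=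
    fun k => rfl
  have foS : ∀ k : Fin n, fo (n + 1) k.succ = ((fo n k).succ.succ : Fin (2 * n + 2)) :=
    fun k => rfl
  unfold pf
  simp only [Finset.mul_sum]
  rw [Finset.sum_sigma']
  symm
  refine Finset.sum_bij (fun q _ => consPairPerm q.1 q.2) ?_ ?_ ?_ ?_
  · rintro ⟨p, ρ⟩ h
    simp only [Finset.mem_sigma, Finset.mem_filter, Finset.mem_univ, true_and] at h ⊢
    refine ⟨fun k => ?_, fun k l hkl => ?_⟩
    · induction k using Fin.cases with
      | zero =>
        rw [fe0, fo0, consPairPerm_zero, consPairPerm_one]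
        exact Fin.succ_pos p
      | succ k =>
        rw [feS, foS, consPairPerm_succ_succ, consPairPerm_succ_succ]
        simpa using h.1 k
    · induction l using Fin.cases with
      | zero => exact absurd hkl (Fin.not_lt_zero k)
      | succ l =>
        induction k using Fin.cases with
        | zero =>
          rw [fe0, feS, consPairPerm_zero, consPairPerm_succ_succ]
          exact Fin.succ_pos _
        | succ k =>
          rw [feS, feS, consPairPerm_succ_succ, consPairPerm_succ_succ]
          simpa using h.2 k l (by simpa using hkl)
  · rintro ⟨p, ρ⟩ _ ⟨p', ρ'⟩ _ h
    have := consPairPerm_injective (a₁ := (p, ρ)) (a₂ := (p', ρ')) h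
    simp only [Prod.mk.injEq] at this
    obtain ⟨rfl, rfl⟩ := this
    rfl
  · intro σ h
    simp only [Finset.mem_filter, Finset.mem_univ, true_and] at h
    have h0 : σ (0 : Fin (2 * n + 2)) = (0 : Fin (2 * n + 2)) := by
      obtain ⟨a, ha⟩ := σ.surjective (0 : Fin (2 * n + 2))
      have hlt : ∀ b : Fin (2 * (n + 1)), ¬ σ b < σ a := fun b hb => by
        rw [ha] at hb
        exact Nat.not_lt_zero _ hb
      rcases Nat.even_or_odd' (a : ℕ) with ⟨c, hc | hc⟩
      · have hcn : c < n + 1 := by have := a.isLt; omega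
        have hac : a = fe (n + 1) ⟨c, hcn⟩ := Fin.ext hc
        rcases Nat.eq_zero_or_pos c with rfl | hpos
        · rw [hac] at ha; exact ha
        · exact absurd (hac ▸ h.2 0 ⟨c, hcn⟩ hpos) (hlt _)
      · have hcn : c < n + 1 := by have := a.isLt; omega
        have hac : a = fo (n + 1) ⟨c, hcn⟩ := Fin.ext hc
        exact absurd (hac ▸ h.1 ⟨c, hcn⟩) (hlt _)
    obtain ⟨p, ρ, rfl⟩ := exists_consPairPerm_eq (m := 2 * n) σ h0
    refine ⟨⟨p, ρ⟩, ?_, rfl⟩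
    simp only [Finset.mem_sigma, Finset.mem_filter, Finset.mem_univ, true_and]
    refine ⟨fun k => ?_, fun k l hkl => ?_⟩
    · have := h.1 k.succ
      rw [feS, foS, consPairPerm_succ_succ, consPairPerm_succ_succ] at this
      simpa using this
    · have := h.2 k.succ l.succ (by simpa using hkl)
      rw [feS, feS, consPairPerm_succ_succ, consPairPerm_succ_succ] at this
      simpa using this
  · rintro ⟨p, ρ⟩ _
    rw [Fin.prod_univ_succ, fe0, fo0]
    simp only [feS, foS]
    have hs : Equiv.Perm.sign (α := Fin (2 * (n + 1))) (consPairPerm p ρ) =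
      (-1) ^ (p : ℕ) * Equiv.Perm.sign ρ := sign_consPairPerm p ρ
    rw [hs, consPairPerm_zero, consPairPerm_one]
    simp only [consPairPerm_succ_succ, Matrix.submatrix_apply]
    push_cast
    ring

/-- **Laksov–Lascoux–Thorup, Stembridge.**
`Pf[(xᵢ-xⱼ)/(1-xᵢxⱼ)]_{1≤i<j≤2n} = ∏_{1≤i<j≤2n} (xᵢ-xⱼ)/(1-xᵢxⱼ)`. -/
theorem stembridge_pfaffian {K : Type*} [Field K] (n : ℕ) (x : Fin (2 * n) → K)
    (h : ∀ i j, i ≠ j → x i * x j ≠ 1) :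
    pf (Matrix.of fun i j : Fin (2 * n) => (x i - x j) / (1 - x i * x j)) =
      ∏ i : Fin (2 * n), ∏ j ∈ Finset.Ioi i, (x i - x j) / (1 - x i * x j) := by
  induction n with
  | zero => simp [pf, Finset.filter_true_of_mem]
  | succ n ih =>
    rw [pf_succ]
    refine Eq.trans ?_ (sum_mul_prod_sub_div (m := 2 * n) (even_two_mul n) x h)
    refine Finset.sum_congr rfl fun p _ => ?_
    rw [← ih (fun i => x (p.succAbove i).succ) fun i j hij =>
      h _ _ ((Fin.succ_injective _).ne (Fin.succAbove_right_injective.ne hij))]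
    rfl
end
end
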